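/- arXiv:math/0612091 — 3 statements merged into one kernel-verified Lean document; each statement's English description precedes it below -/
import Mathlib

section
/- Let A be an associative unital ℂ-algebra and let a, b ∈ A satisfy a² = b² = 0 (so that 1+a and 1+b are units, with inverses 1−a and 1−b). Then (1+a, 1+b) is a free pair if and only if one of the following holds: (1) a·b is transcendental over ℚ; (2) a·b is algebraic over ℚ and some complex root λ of the minimal polynomial of a·b over ℂ (i.e. some eigenvalue of a·b) is a free point. -/
/-- `u` and `v` form a free pair: the homomorphism from the free group on two
generators sending the generators to `u` and `v` is injective. -/
def IsFreePair {G : Type*} [Group G] (u v : G) : Prop :=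
  Function.Injective ((FreeGroup.lift (fun b : Bool => if b then u else v)) : FreeGroup Bool →* G)

/-- `z : ℂ` is a free point: the matrices `[[1,1],[0,1]]` and `[[1,0],[z,1]]`
form a free pair in the unit group of `M₂(ℂ)`. -/
def IsFreePoint (z : ℂ) : Prop :=
  ∀ U V : (Matrix (Fin 2) (Fin 2) ℂ)ˣ,
    (U : Matrix (Fin 2) (Fin 2) ℂ) = !![1, 1; 0, 1] →
    (V : Matrix (Fin 2) (Fin 2) ℂ) = !![1, 0; z, 1] →
    IsFreePair U V

/-- `x` is transcendental over `ℚ`, where a `ℂ`-algebra is viewed as a `ℚ`-algebra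
via `ℚ → ℂ → A`. -/
def TranscendentalQ {A : Type*} [Ring A] [Algebra ℂ A] (x : A) : Prop :=
  ∀ p : Polynomial ℚ, p ≠ 0 →
    Polynomial.eval₂ ((algebraMap ℂ A).comp (algebraMap ℚ ℂ)) x p ≠ 0

open Polynomial Matrix

/-- The upper unipotent matrix as a unit. -/
def unipU (R : Type*) [CommRing R] : (Matrix (Fin 2) (Fin 2) R)ˣ where
  val := !![1, 1; 0, 1]
  inv := !![1, -1; 0, 1]
  val_inv := by ext i j; fin_cases i <;> fin_cases j <;> simp [Matrix.mul_apply]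
  inv_val := by ext i j; fin_cases i <;> fin_cases j <;> simp [Matrix.mul_apply]

/-- The lower unipotent matrix as a unit. -/
def unipV {R : Type*} [CommRing R] (z : R) : (Matrix (Fin 2) (Fin 2) R)ˣ where
  val := !![1, 0; z, 1]
  inv := !![1, 0; -z, 1]
  val_inv := by ext i j; fin_cases i <;> fin_cases j <;> simp [Matrix.mul_apply]
  inv_val := by ext i j; fin_cases i <;> fin_cases j <;> simp [Matrix.mul_apply]

/-- The representation of the free group attached to a parameter `z`. -/
def rho {R : Type*} [CommRing R] (z : R) : FreeGroup Bool →* (Matrix (Fin 2) (Fin 2) R)ˣ :=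
  FreeGroup.lift (fun b : Bool => if b then unipU R else unipV z)

theorem rho_map {R S : Type*} [CommRing R] [CommRing S] (f : R →+* S) (z : R)
    (w : FreeGroup Bool) :
    ((rho z w : (Matrix (Fin 2) (Fin 2) R)ˣ) : Matrix (Fin 2) (Fin 2) R).map f
      = ((rho (f z) w : (Matrix (Fin 2) (Fin 2) S)ˣ) : Matrix (Fin 2) (Fin 2) S) := by
  have h : (Units.map (f.mapMatrix : Matrix (Fin 2) (Fin 2) R →+* _).toMonoidHom).comp (rho z)
      = rho (f z) := by
    apply FreeGroup.ext_hom
    intro b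
    ext i j
    cases b <;> fin_cases i <;> fin_cases j <;> simp [rho, unipU, unipV]
  have h2 := DFunLike.congr_fun h w
  have h3 := congrArg (fun u : (Matrix (Fin 2) (Fin 2) S)ˣ => (u : Matrix (Fin 2) (Fin 2) S)) h2
  simpa using h3

theorem isFreePoint_iff (z : ℂ) : IsFreePoint z ↔ ∀ w, rho z w = 1 → w = 1 := by
  constructor
  · intro h
    have := h (unipU ℂ) (unipV z) rfl rfl
    exact fun w hw => (injective_iff_map_eq_one (rho z)).1 this w hw
  · intro h U V hU hV
    have h1 : U = unipU ℂ := Units.ext hU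
    have h2 : V = unipV z := Units.ext hV
    subst h1 h2
    exact (injective_iff_map_eq_one (rho z)).2 h

/-- Ping-pong sets. -/
def pp : Bool × Bool → ℤ → ℤ → Prop
  | (true, true), x, y => y ^ 2 ≤ 2 * x * y
  | (true, false), x, y => y ^ 2 ≤ -(2 * x * y)
  | (false, true), x, y => 16 * x ^ 2 ≤ 2 * x * y
  | (false, false), x, y => 16 * x ^ 2 ≤ -(2 * x * y)

theorem pp_disj (l l' : Bool × Bool) (x y : ℤ) (hx : x ≠ 0) (hy : y ≠ 0) (h : pp l x y)
    (h' : pp l' x y) : l = l' := by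
  have hx2 : 0 < x ^ 2 := by positivity
  have hy2 : 0 < y ^ 2 := by positivity
  have hxy : 0 < x ^ 2 * y ^ 2 := by positivity
  rcases l with ⟨_ | _, _ | _⟩ <;> rcases l' with ⟨_ | _, _ | _⟩ <;> simp only [pp] at h h' ⊢ <;>
    first
    | (exfalso; linarith)
    | (exfalso; nlinarith)

theorem pp_not_base (l : Bool × Bool) (c : ℤ) (hc : c ≠ 0) : ¬ pp l c (4 * c) := by
  have hc2 : 0 < c ^ 2 := by positivity
  rcases l with ⟨_ | _, _ | _⟩ <;> simp only [pp] <;> nlinarith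

/-- The matrix of one letter. -/
def letterMat (l : Bool × Bool) : (Matrix (Fin 2) (Fin 2) ℤ)ˣ :=
  cond l.2 (if l.1 then unipU ℤ else unipV 16) (if l.1 then unipU ℤ else unipV 16)⁻¹

theorem pp_step (l : Bool × Bool) (x y : ℤ) (hx : x ≠ 0) (hy : y ≠ 0)
    (h : ¬ pp (l.1, !l.2) x y) :
    let v := (letterMat l : Matrix (Fin 2) (Fin 2) ℤ) *ᵥ ![x, y]
    v 0 ≠ 0 ∧ v 1 ≠ 0 ∧ pp l (v 0) (v 1) := by
  have hx2 : 0 < x ^ 2 := by positivity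
  have hy2 : 0 < y ^ 2 := by positivity
  rcases l with ⟨_ | _, _ | _⟩ <;>
    simp [pp, letterMat, unipU, unipV, hx, hy, Matrix.mulVec, dotProduct] at h ⊢
  · refine ⟨?_, by nlinarith⟩
    intro h0
    have : y = 16 * x := by linarith
    subst this; nlinarith
  · refine ⟨?_, by nlinarith⟩
    intro h0
    have : y = -16 * x := by linarith
    subst this; nlinarith
  · refine ⟨?_, by nlinarith⟩
    intro h0
    have : x = y := by linarith
    subst this; nlinarith
  · refine ⟨?_, by nlinarith⟩
    intro h0
    have : x = -y := by linarith
    subst this; nlinarith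

theorem pp_word (L : List (Bool × Bool)) (hL : FreeGroup.IsReduced L) :
    let v := ((L.map letterMat).prod : Matrix (Fin 2) (Fin 2) ℤ) *ᵥ ![1, 4]
    v 0 ≠ 0 ∧ v 1 ≠ 0 ∧ (∀ l, L.head? = some l → pp l (v 0) (v 1)) ∧
      (L = [] → v = ![1, 4]) := by
  induction L with
  | nil => simp
  | cons l L ih =>
    have hL' : FreeGroup.IsReduced L := hL.infix ⟨[l], [], by simp⟩
    obtain ⟨h0, h1, h2, h3⟩ := ih hL'
    set v := ((L.map letterMat).prod : Matrix (Fin 2) (Fin 2) ℤ) *ᵥ ![1, 4] with hv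
    have hvv : v = ![v 0, v 1] := by ext i; fin_cases i <;> rfl
    have hnot : ¬ pp (l.1, !l.2) (v 0) (v 1) := by
      cases L with
      | nil =>
        have := h3 rfl
        rw [this]
        simpa using pp_not_base (l.1, !l.2) 1 one_ne_zero
      | cons l' L =>
        intro hp
        have h4 := pp_disj _ _ _ _ h0 h1 hp (h2 l' rfl)
        rw [FreeGroup.isReduced_cons_cons] at hL
        have h5 := hL.1
        rw [← h4] at h5
        simp at h5
    have key := pp_step l (v 0) (v 1) h0 h1 hnot
    rw [← hvv] at key
    have hw : (((l :: L).map letterMat).prod : Matrix (Fin 2) (Fin 2) ℤ) *ᵥ ![1, 4]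
        = (letterMat l : Matrix (Fin 2) (Fin 2) ℤ) *ᵥ v := by
      rw [hv, Matrix.mulVec_mulVec]
      simp
    intro v'
    have hv' : v' = (letterMat l : Matrix (Fin 2) (Fin 2) ℤ) *ᵥ v := hw
    rw [hv']
    refine ⟨key.1, key.2.1, ?_, by simp⟩
    intro l' hl'
    simp at hl'
    subst hl'
    exact key.2.2

/-- Non-trivial words are not scalar at the parameter `16`. -/
theorem rho_not_scalar (w : FreeGroup Bool) (hw : w ≠ 1) (c : ℤ) :
    ((rho (16 : ℤ) w : (Matrix (Fin 2) (Fin 2) ℤ)ˣ) : Matrix (Fin 2) (Fin 2) ℤ)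
      ≠ !![c, 0; 0, c] := by
  intro h
  have hp := pp_word w.toWord FreeGroup.isReduced_toWord
  have hmk : (w.toWord.map letterMat).prod = rho (16 : ℤ) w := by
    conv_rhs => rw [← FreeGroup.mk_toWord (x := w)]
    rw [rho, FreeGroup.lift_mk]
    rfl
  rw [hmk, h] at hp
  obtain ⟨h0, h1, h2, -⟩ := hp
  cases hL : w.toWord with
  | nil => exact hw (FreeGroup.toWord_eq_nil_iff.1 hL)
  | cons l L =>
    have h3 := h2 l (by rw [hL]; rfl)
    simp [Matrix.mulVec, dotProduct] at h0 h1 h3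
    rw [mul_comm] at h3
    exact pp_not_base l c h0 h3

theorem rho_X_injective (w : FreeGroup Bool) (h : rho (X : ℤ[X]) w = 1) : w = 1 := by
  by_contra hw
  apply rho_not_scalar w hw 1
  have := rho_map (Polynomial.evalRingHom (16 : ℤ)) X w
  rw [h] at this
  simp at this
  rw [← this]
  ext i j
  fin_cases i <;> fin_cases j <;> simp

theorem comm_entries {R : Type*} [CommRing R] {M N : Matrix (Fin 2) (Fin 2) R}
    (h : M * N = N * M) :
    M 0 1 * N 1 0 = N 0 1 * M 1 0 ∧
    M 0 1 * (N 0 0 - N 1 1) = N 0 1 * (M 0 0 - M 1 1) ∧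
    M 1 0 * (N 0 0 - N 1 1) = N 1 0 * (M 0 0 - M 1 1) := by
  have h00 := congrFun (congrFun h 0) 0
  have h01 := congrFun (congrFun h 0) 1
  have h10 := congrFun (congrFun h 1) 0
  simp [Matrix.mul_apply] at h00 h01 h10
  refine ⟨by linear_combination h00, by linear_combination -h01, by linear_combination h10⟩

theorem conj_aux (p q r p' q' r' : ℤ) (h1 : q * r' = q' * r) (h2 : q * p' = q' * p)
    (h3 : r * p' = r' * p) (h4 : q * r' = (q' - p' - r') * r)
    (h5 : q * (p' + 2 * r') = (q' - p' - r') * p) (h6 : r * (p' + 2 * r') = r' * p)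
    (h7 : q * (r' + 16 * p' - 256 * q') = q' * r) (h8 : q * (p' - 32 * q') = q' * p)
    (hX : ¬ (q = 0 ∧ r = 0 ∧ p = 0)) (hY : ¬ (q' = 0 ∧ r' = 0 ∧ p' = 0)) : False := by
  have a1 : r * r' = 0 := by linarith
  have a2 : q * q' = 0 := by linarith
  have a3 : r * p' = 0 := by linarith
  have a4 : q * p' = 0 := by linarith
  by_cases hr : r = 0
  · subst hr
    by_cases hq : q = 0
    · subst hq
      have hp : p ≠ 0 := fun h => hX ⟨rfl, rfl, h⟩
      have b1 : q' = 0 := by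
        have : q' * p = 0 := by linarith
        exact (mul_eq_zero.1 this).resolve_right hp
      have b2 : r' = 0 := by
        have : r' * p = 0 := by linarith
        exact (mul_eq_zero.1 this).resolve_right hp
      subst b1 b2
      have : p' * p = 0 := by linarith
      exact hY ⟨rfl, rfl, (mul_eq_zero.1 this).resolve_right hp⟩
    · have : q * r' = 0 := by linarith
      exact hY ⟨(mul_eq_zero.1 a2).resolve_left hq, (mul_eq_zero.1 this).resolve_left hq,
        (mul_eq_zero.1 a4).resolve_left hq⟩
  · have b1 := (mul_eq_zero.1 a1).resolve_left hr
    have b2 := (mul_eq_zero.1 a3).resolve_left hr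
    subst b1
    have : q' * r = 0 := by linarith
    exact hY ⟨(mul_eq_zero.1 this).resolve_right hr, rfl, b2⟩

/-- Two nontrivial words: some conjugate of the second does not commute with the first. -/
theorem exists_conj (u v : FreeGroup Bool) (hu : u ≠ 1) (hv : v ≠ 1) :
    ∃ g, ¬ Commute u (g * v * g⁻¹) := by
  by_contra! hcon
  have key : ∀ g, (rho (16 : ℤ) u : Matrix (Fin 2) (Fin 2) ℤ) * (rho (16 : ℤ) (g * v * g⁻¹)).1
      = (rho (16 : ℤ) (g * v * g⁻¹)).1 * (rho (16 : ℤ) u : Matrix (Fin 2) (Fin 2) ℤ) := by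
    intro g
    have := congrArg (fun t => (rho (16 : ℤ) t).1) (hcon g).eq
    simpa only [map_mul, Units.val_mul] using this
  have e1 := comm_entries (key 1)
  have e2 := comm_entries (key (FreeGroup.of true))
  have e3 := comm_entries (key (FreeGroup.of false))
  have hX := rho_not_scalar u hu
  have hY := rho_not_scalar v hv
  simp only [map_mul, map_inv, map_one, Units.val_mul] at e1 e2 e3
  have hU : rho (16 : ℤ) (FreeGroup.of true) = unipU ℤ := by simp [rho]
  have hV : rho (16 : ℤ) (FreeGroup.of false) = unipV 16 := by simp [rho]
  rw [hU] at e2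
  rw [hV] at e3
  generalize (rho (16 : ℤ) u : Matrix (Fin 2) (Fin 2) ℤ) = M at *
  generalize (rho (16 : ℤ) v : Matrix (Fin 2) (Fin 2) ℤ) = N at *
  simp [unipU, unipV, Matrix.mul_apply, Matrix.vecMul, dotProduct] at e1 e2 e3
  have hX' : ¬ (M 0 1 = 0 ∧ M 1 0 = 0 ∧ M 0 0 - M 1 1 = 0) := by
    rintro ⟨h1, h2, h3⟩
    apply hX (M 0 0)
    ext i j
    fin_cases i <;> fin_cases j <;> simp [h1, h2]
    linarith
  have hY' : ¬ (N 0 1 = 0 ∧ N 1 0 = 0 ∧ N 0 0 - N 1 1 = 0) := by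
    rintro ⟨h1, h2, h3⟩
    apply hY (N 0 0)
    ext i j
    fin_cases i <;> fin_cases j <;> simp [h1, h2]
    linarith
  clear hX hY hcon key
  exact conj_aux (M 0 0 - M 1 1) (M 0 1) (M 1 0) (N 0 0 - N 1 1) (N 0 1) (N 1 0)
    (by linear_combination e1.1) (by linear_combination e1.2.1) (by linear_combination e1.2.2)
    (by linear_combination e2.1) (by linear_combination e2.2.1) (by linear_combination e2.2.2)
    (by linear_combination e3.1) (by linear_combination e3.2.1) hX' hY'

theorem exists_word (s : Multiset ℂ) (hs : ∀ z ∈ s, ¬ IsFreePoint z) :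
    ∃ w : FreeGroup Bool, w ≠ 1 ∧ ∃ N : Matrix (Fin 2) (Fin 2) ℂ[X],
      ((rho (X : ℂ[X]) w : (Matrix (Fin 2) (Fin 2) ℂ[X])ˣ) : Matrix (Fin 2) (Fin 2) ℂ[X])
        = 1 + (s.map (fun z => X - C z)).prod • N := by
  induction s using Multiset.induction_on with
  | empty =>
    refine ⟨FreeGroup.of true, FreeGroup.of_ne_one _,
      ((rho (X : ℂ[X]) (FreeGroup.of true)).1 - 1), ?_⟩
    simp
  | cons z s ih =>
    obtain ⟨v, hv, N2, hN2⟩ := ih (fun y hy => hs y (Multiset.mem_cons_of_mem hy))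
    have hz := hs z (Multiset.mem_cons_self z s)
    rw [isFreePoint_iff] at hz
    push Not at hz
    obtain ⟨u, hu, hu1⟩ := hz
    have hdvd : ∀ i j, (X - C z) ∣ ((rho (X : ℂ[X]) u).1 - 1) i j := by
      intro i j
      rw [Polynomial.dvd_iff_isRoot, Polynomial.IsRoot.def]
      have h1 := rho_map (Polynomial.evalRingHom z) X u
      simp only [Polynomial.coe_evalRingHom, Polynomial.eval_X] at h1
      rw [hu] at h1
      have h2 := congrFun (congrFun h1 i) j
      simp only [Matrix.map_apply, Units.val_one] at h2
      rw [Matrix.sub_apply, Polynomial.eval_sub, h2]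
      fin_cases i <;> fin_cases j <;> simp
    choose f hf using hdvd
    have hN1 : (rho (X : ℂ[X]) u).1 = 1 + (X - C z) • (Matrix.of f) := by
      rw [← sub_eq_iff_eq_add']
      ext1 i j
      rw [hf]
      simp
    obtain ⟨g, hg⟩ := exists_conj u v hu1 hv
    refine ⟨u * (g * v * g⁻¹) * u⁻¹ * (g * v * g⁻¹)⁻¹, ?_, ?_⟩
    · intro h
      apply hg
      rw [mul_inv_eq_one, mul_inv_eq_iff_eq_mul] at h
      exact h
    · have hN3 : (rho (X : ℂ[X]) (g * v * g⁻¹)).1 = 1 + (s.map (fun z => X - C z)).prod •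
          ((rho (X : ℂ[X]) g).1 * N2 * (rho (X : ℂ[X]) g⁻¹).1) := by
        rw [map_mul, map_mul, Units.val_mul, Units.val_mul, hN2, mul_add, add_mul, mul_one,
          ← Units.val_mul, ← map_mul, mul_inv_cancel, map_one, Units.val_one]
        simp
      generalize g * v * g⁻¹ = k at *
      generalize (rho (X : ℂ[X]) g).1 * N2 * (rho (X : ℂ[X]) g⁻¹).1 = N3 at *
      refine ⟨(Matrix.of f * N3 - N3 * Matrix.of f) *
        ((rho (X : ℂ[X]) u⁻¹).1 * (rho (X : ℂ[X]) k⁻¹).1), ?_⟩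
      rw [Multiset.map_cons, Multiset.prod_cons]
      generalize (s.map (fun z => X - C z)).prod = d at *
      have hc : (rho (X : ℂ[X]) u).1 * (rho (X : ℂ[X]) k).1
          = (rho (X : ℂ[X]) k).1 * (rho (X : ℂ[X]) u).1
            + ((X - C z) * d) • (Matrix.of f * N3 - N3 * Matrix.of f) := by
        rw [hN1, hN3]
        simp only [mul_add, add_mul, mul_one, one_mul, Matrix.smul_mul, Matrix.mul_smul, smul_sub,
          smul_smul]
        rw [mul_comm d]
        abel
      have hone : (rho (X : ℂ[X]) k).1 * (rho (X : ℂ[X]) u).1 *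
          ((rho (X : ℂ[X]) u⁻¹).1 * (rho (X : ℂ[X]) k⁻¹).1) = 1 := by
        rw [← Units.val_mul, ← Units.val_mul, ← Units.val_mul, ← map_mul, ← map_mul, ← map_mul]
        simp
      rw [map_mul, map_mul, map_mul, Units.val_mul, Units.val_mul, Units.val_mul, mul_assoc, hc,
        add_mul, hone, Matrix.smul_mul]

section phi

variable {A : Type*} [Ring A]

/-- Evaluation of the non-unital matrix `[[X p, q], [X r, X s]]` in the ring `A`. -/
noncomputable def Phi (a b : A) (p q r s : ℤ[X]) : A :=
  a * b * aeval (a * b) p + aeval (a * b) q * a + b * aeval (a * b) r + b * aeval (a * b) s * a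

theorem sandwich_a (a b : A) (ha : a * a = 0) (p : ℤ[X]) : a * aeval (a * b) p * a = 0 := by
  induction p using Polynomial.induction_on' with
  | add p q hp hq => rw [map_add, mul_add, add_mul, hp, hq, add_zero]
  | monomial n c =>
    rw [Polynomial.aeval_monomial]
    cases n with
    | zero => rw [pow_zero, mul_one, ← Algebra.commutes, mul_assoc, ha, mul_zero]
    | succ n =>
      rw [pow_succ', ← mul_assoc, ← Algebra.commutes, mul_assoc, mul_assoc, ← mul_assoc a,
        ← mul_assoc a, ← mul_assoc a, ha]
      simp

theorem sandwich_b (a b : A) (hb : b * b = 0) (p : ℤ[X]) : b * aeval (a * b) p * b = 0 := by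
  induction p using Polynomial.induction_on' with
  | add p q hp hq => rw [map_add, mul_add, add_mul, hp, hq, add_zero]
  | monomial n c =>
    rw [Polynomial.aeval_monomial]
    cases n with
    | zero => rw [pow_zero, mul_one, ← Algebra.commutes, mul_assoc, hb, mul_zero]
    | succ n =>
      rw [pow_succ, ← mul_assoc, ← mul_assoc, ← mul_assoc, mul_assoc _ b b, hb]
      simp

theorem Phi_mul (a b : A) (ha : a * a = 0) (hb : b * b = 0) (p q r s p' q' r' s' : ℤ[X]) :
    Phi a b p q r s * Phi a b p' q' r' s'
      = Phi a b (X * p * p' + q * r') (X * p * q' + X * q * s') (X * r * p' + X * s * r')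
          (r * q' + X * s * s') := by
  have ca : ∀ f : ℤ[X], aeval (a * b) f * (a * b) = (a * b) * aeval (a * b) f := by
    intro f
    have : aeval (a * b) (f * X) = aeval (a * b) (X * f) := by rw [mul_comm]
    simpa using this
  have sa' : ∀ (f : ℤ[X]), a * (aeval (a * b) f * a) = 0 := by
    intro f
    rw [← mul_assoc, sandwich_a a b ha]
  have sb : ∀ (f : ℤ[X]) (y : A), b * (aeval (a * b) f * (b * y)) = 0 := by
    intro f y
    rw [← mul_assoc, ← mul_assoc, sandwich_b a b hb, zero_mul]
  have aa : ∀ y : A, a * (a * y) = 0 := by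
    intro y; rw [← mul_assoc, ha, zero_mul]
  have cab : ∀ (f : ℤ[X]) (y : A), aeval (a * b) f * (a * (b * y))
      = a * (b * (aeval (a * b) f * y)) := by
    intro f y
    rw [← mul_assoc a b, ← mul_assoc, ca]
    simp only [mul_assoc]
  simp only [Phi, map_add, map_mul, aeval_X]
  simp only [mul_add, add_mul, mul_assoc, sa', sb, aa, cab, mul_zero, add_zero, zero_add]
  abel

/-- Simultaneous description of a word in the matrix ring and in `A`. -/
theorem word_form (a b : A) (ha : a * a = 0) (hb : b * b = 0) (α β : Aˣ)
    (hα : (α : A) = 1 + a) (hβ : (β : A) = 1 + b) (w : FreeGroup Bool) :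
    ∃ p q r s : ℤ[X],
      (rho (X : ℤ[X]) w).1 = 1 + !![X * p, q; X * r, X * s] ∧
      ((FreeGroup.lift (fun c : Bool => if c then α else β) w : Aˣ) : A)
        = 1 + Phi a b p q r s := by
  have hα' : ((α⁻¹ : Aˣ) : A) = 1 - a := by
    apply Units.inv_eq_of_mul_eq_one_right
    rw [hα, add_mul, one_mul, mul_sub, mul_one, ha]
    abel
  have hβ' : ((β⁻¹ : Aˣ) : A) = 1 - b := by
    apply Units.inv_eq_of_mul_eq_one_right
    rw [hβ, add_mul, one_mul, mul_sub, mul_one, hb]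
    abel
  induction w using FreeGroup.induction_on with
  | C1 => 
    refine ⟨0, 0, 0, 0, ?_, ?_⟩
    · rw [map_one, Units.val_one]; ext i j; fin_cases i <;> fin_cases j <;> simp
    · simp [Phi]
  | of c =>
    cases c
    · refine ⟨0, 0, 1, 0, ?_, ?_⟩
      · ext1 i j; fin_cases i <;> fin_cases j <;> simp [rho, unipV]
      · simp [Phi, hβ]
    · refine ⟨0, 1, 0, 0, ?_, ?_⟩
      · ext1 i j; fin_cases i <;> fin_cases j <;> simp [rho, unipU]
      · simp [Phi, hα]
  | inv_of c =>
    cases c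
    · refine ⟨0, 0, -1, 0, ?_, ?_⟩
      · ext1 i j; fin_cases i <;> fin_cases j <;> simp [rho, unipV]
      · simp [Phi, hβ', sub_eq_add_neg]
    · refine ⟨0, -1, 0, 0, ?_, ?_⟩
      · ext1 i j; fin_cases i <;> fin_cases j <;> simp [rho, unipU]
      · simp [Phi, hα', sub_eq_add_neg]
  | mul x y hx hy =>
    obtain ⟨p, q, r, s, h1, h2⟩ := hx
    obtain ⟨p', q', r', s', h1', h2'⟩ := hy
    refine ⟨p + p' + (X * p * p' + q * r'), q + q' + (X * p * q' + X * q * s'),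
      r + r' + (X * r * p' + X * s * r'), s + s' + (r * q' + X * s * s'), ?_, ?_⟩
    · rw [map_mul, Units.val_mul, h1, h1']
      ext1 i j
      fin_cases i <;> fin_cases j <;> simp [Matrix.mul_apply, Fin.sum_univ_two] <;> ring
    · rw [map_mul, Units.val_mul, h2, h2', mul_add, mul_one,
        add_mul 1 (Phi a b p q r s), one_mul, Phi_mul a b ha hb]
      simp only [Phi, map_add, mul_add, add_mul]
      abel

theorem Phi_zero (a b : A) (ha : a * a = 0) (hb : b * b = 0) (p q r s : ℤ[X])
    (h : Phi a b p q r s = 0) :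
    aeval (a * b) (X ^ 3 * p) = 0 ∧ aeval (a * b) (X ^ 3 * q) = 0 ∧
      aeval (a * b) (X ^ 3 * r) = 0 ∧ aeval (a * b) (X ^ 3 * s) = 0 := by
  have hP : ∀ p : ℤ[X], Phi a b p 0 0 0 = aeval (a * b) (X * p) := by
    intro p; simp [Phi]
  have f1 : Phi a b 1 0 0 0 * Phi a b p q r s * Phi a b 1 0 0 0 = 0 := by simp [h]
  have f2 : Phi a b 1 0 0 0 * Phi a b p q r s * Phi a b 0 0 1 0 = 0 := by simp [h]
  have f3 : Phi a b 0 1 0 0 * Phi a b p q r s * Phi a b 1 0 0 0 = 0 := by simp [h]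
  have f4 : Phi a b 0 1 0 0 * Phi a b p q r s * Phi a b 0 0 1 0 = 0 := by simp [h]
  simp only [Phi_mul a b ha hb, mul_zero, zero_mul, add_zero, zero_add, mul_one, one_mul]
    at f1 f2 f3 f4
  rw [hP] at f1 f2 f3 f4
  have up : ∀ (t f : ℤ[X]), aeval (a * b) f = 0 → aeval (a * b) (t * f) = 0 := by
    intro t f hf; rw [map_mul, hf, mul_zero]
  refine ⟨?_, ?_, ?_, ?_⟩
  · convert f1 using 2; ring
  · convert up X _ f2 using 2; ring
  · convert up X _ f3 using 2; ring
  · convert up X _ f4 using 2; ring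

end phi

theorem aeval_int_map {A : Type*} [Ring A] [Algebra ℂ A] (x : A) (f : ℤ[X]) :
    aeval x (f.map (Int.castRingHom ℂ)) = aeval x f := by
  rw [aeval_def, eval₂_map, aeval_def]
  congr 1
  exact RingHom.ext_int _ _

theorem not_isFreePoint_zero : ¬ IsFreePoint 0 := by
  rw [isFreePoint_iff]
  intro h
  refine FreeGroup.of_ne_one false (h (FreeGroup.of false) (Units.ext ?_))
  ext i j
  fin_cases i <;> fin_cases j <;> simp [rho, unipV]

/-- **Theorem 1 (freeness criterion).** Let `A` be a unital associative `ℂ`-algebra and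
`a, b ∈ A` with `a² = b² = 0`, and let `α = 1 + a`, `β = 1 + b` be the corresponding
units. Then `(1+a, 1+b)` is a free pair iff either `ab` is transcendental over `ℚ`,
or `ab` is algebraic over `ℚ` and some eigenvalue of `ab` (i.e. some complex root of
the minimal polynomial of `ab` over `ℂ`) is a free point. -/
theorem criteria_free_pair (A : Type*) [Ring A] [Algebra ℂ A] (a b : A)
    (ha : a ^ 2 = 0) (hb : b ^ 2 = 0)
    (α β : Aˣ) (hα : (α : A) = 1 + a) (hβ : (β : A) = 1 + b) :
    IsFreePair α β ↔
      (TranscendentalQ (a * b) ∨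
        (¬ TranscendentalQ (a * b) ∧
          ∃ lam : ℂ, (minpoly ℂ (a * b)).IsRoot lam ∧ IsFreePoint lam)) := by
  have ha' : a * a = 0 := by rw [← pow_two, ha]
  have hb' : b * b = 0 := by rw [← pow_two, hb]
  have form := word_form a b ha' hb' α β hα hβ
  have hone : ∀ M : Matrix (Fin 2) (Fin 2) ℤ[X], M = 0 → 1 + M = 1 := by
    rintro _ rfl; simp
  constructor
  · intro hfree
    by_cases htr : TranscendentalQ (a * b)
    · exact Or.inl htr
    refine Or.inr ⟨htr, ?_⟩
    by_contra! hcon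
    -- the minimal polynomial is nonzero
    have hm : minpoly ℂ (a * b) ≠ 0 := by
      unfold TranscendentalQ at htr
      push Not at htr
      obtain ⟨f, hf, hf0⟩ := htr
      have hfm : f.map (algebraMap ℚ ℂ) ≠ 0 :=
        (Polynomial.map_ne_zero_iff (algebraMap ℚ ℂ).injective).2 hf
      have halg : IsAlgebraic ℂ (a * b) :=
        ⟨f.map (algebraMap ℚ ℂ), hfm, by rw [aeval_def, eval₂_map]; exact hf0⟩
      exact minpoly.ne_zero halg.isIntegral
    have h0 : ¬ IsFreePoint 0 := not_isFreePoint_zero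
    obtain ⟨w, hw, N, hN⟩ := exists_word (0 ::ₘ (minpoly ℂ (a * b)).roots) (by
      intro z hz
      rw [Multiset.mem_cons] at hz
      rcases hz with rfl | hz
      · exact h0
      · exact hcon z (Polynomial.isRoot_of_mem_roots hz))
    have hprod : ((minpoly ℂ (a * b)).roots.map (fun z => X - C z)).prod
        = minpoly ℂ (a * b) := by
      have hmonic : (minpoly ℂ (a * b)).Monic := minpoly.monic (minpoly.ne_zero_iff.1 hm)
      exact ((IsAlgClosed.splits _).eq_prod_roots_of_monic hmonic).symm
    rw [Multiset.map_cons, Multiset.prod_cons, hprod, C_0, sub_zero] at hN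
    obtain ⟨p, q, r, s, h1, h2⟩ := form w
    have hmap := rho_map (Polynomial.mapRingHom (Int.castRingHom ℂ)) X w
    rw [Polynomial.coe_mapRingHom, Polynomial.map_X, hN, h1] at hmap
    have hX : (X : ℂ[X]) ≠ 0 := X_ne_zero
    have kill : ∀ f : ℤ[X], minpoly ℂ (a * b) ∣ f.map (Int.castRingHom ℂ) →
        aeval (a * b) f = 0 := by
      intro f hf
      obtain ⟨g, hg⟩ := hf
      rw [← aeval_int_map, hg, map_mul, minpoly.aeval, zero_mul]
    have k00 := congrFun (congrFun hmap 0) 0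
    have k01 := congrFun (congrFun hmap 0) 1
    have k10 := congrFun (congrFun hmap 1) 0
    have k11 := congrFun (congrFun hmap 1) 1
    simp [mul_assoc] at k00 k01 k10 k11
    apply hw
    refine (injective_iff_map_eq_one _).1 hfree w (Units.ext ?_)
    rw [h2, Phi, kill p ⟨N 0 0, k00⟩, kill q ⟨X * N 0 1, by rw [k01]; ring⟩,
      kill r ⟨N 1 0, k10⟩, kill s ⟨N 1 1, k11⟩]
    simp
  · intro h
    refine (injective_iff_map_eq_one _).2 fun w hw => ?_
    obtain ⟨p, q, r, s, h1, h2⟩ := form w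
    rw [hw, Units.val_one, left_eq_add] at h2
    obtain ⟨e1, e2, e3, e4⟩ := Phi_zero a b ha' hb' p q r s h2
    rcases h with htr | ⟨-, lam, hroot, hlam⟩
    · have kill : ∀ f : ℤ[X], aeval (a * b) (X ^ 3 * f) = 0 → f = 0 := by
        intro f hf
        by_contra hne
        refine htr ((X ^ 3 * f).map (Int.castRingHom ℚ)) ?_ ?_
        · rw [Polynomial.map_ne_zero_iff (Int.cast_injective)]
          exact mul_ne_zero (pow_ne_zero _ X_ne_zero) hne
        · rw [eval₂_map, ← hf, aeval_def]
          congr 1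
          exact RingHom.ext_int _ _
      apply rho_X_injective
      apply Units.ext
      rw [h1, kill p e1, kill q e2, kill r e3, kill s e4]
      apply hone
      ext1 i j
      fin_cases i <;> fin_cases j <;> simp
    · have hl0 : lam ≠ 0 := by
        rintro rfl
        exact not_isFreePoint_zero hlam
      have kill : ∀ f : ℤ[X], aeval (a * b) (X ^ 3 * f) = 0 →
          eval₂ (Int.castRingHom ℂ) lam f = 0 := by
        intro f hf
        have hd : minpoly ℂ (a * b) ∣ (X ^ 3 * f).map (Int.castRingHom ℂ) := by
          apply minpoly.dvd
          rw [aeval_int_map, hf]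
        have := hroot.dvd hd
        rw [IsRoot.def, eval_map, eval₂_mul, eval₂_pow, eval₂_X] at this
        exact (mul_eq_zero.1 this).resolve_left (pow_ne_zero _ hl0)
      apply (isFreePoint_iff lam).1 hlam
      apply Units.ext
      have hmap := rho_map (Polynomial.eval₂RingHom (Int.castRingHom ℂ) lam) X w
      rw [coe_eval₂RingHom, eval₂_X] at hmap
      rw [← hmap, h1]
      ext1 i j
      fin_cases i <;> fin_cases j <;>
        simp [kill p e1, kill q e2, kill r e3, kill s e4, eval₂_mul]
end

section
/- Let G be a finite group and let α be a non-trivial bicyclic unit of the integral group ring ℤG. Then there exist bicyclic units β and γ of ℤG of different types (one of type β_{·,·}, the other of type γ_{·,·}) such that (α, β) and (α, γ) are both free pairs in the unit group of ℤG. -/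
/-- `ĥ = 1 + h + h² + ⋯ + h^{d-1}` in `ℤG`, where `d` is the order of `h`. -/
noncomputable def hat {G : Type*} [Group G] (h : G) : MonoidAlgebra ℤ G :=
  ∑ i ∈ Finset.range (orderOf h), (MonoidAlgebra.of ℤ G h) ^ i

/-- The bicyclic unit `β_{x,h} = 1 + (1 − h)·x·ĥ` of `ℤG`. -/
noncomputable def bicyclicBeta {G : Type*} [Group G] (x h : G) : MonoidAlgebra ℤ G :=
  1 + (1 - MonoidAlgebra.of ℤ G h) * MonoidAlgebra.of ℤ G x * hat h

/-- The bicyclic unit `γ_{x,h} = 1 + ĥ·x·(1 − h)` of `ℤG`. -/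
noncomputable def bicyclicGamma {G : Type*} [Group G] (x h : G) : MonoidAlgebra ℤ G :=
  1 + hat h * MonoidAlgebra.of ℤ G x * (1 - MonoidAlgebra.of ℤ G h)

/-- `u ∈ ℤG` is a bicyclic unit (of either type). -/
def IsBicyclicUnit {G : Type*} [Group G] (u : MonoidAlgebra ℤ G) : Prop :=
  ∃ x h : G, u = bicyclicBeta x h ∨ u = bicyclicGamma x h

lemma exists_eig {W : Type*} [AddCommGroup W] [Module ℂ W] [FiniteDimensional ℂ W]
    (S : Module.End ℂ W) (c : ℝ) (hW : 0 < Module.finrank ℂ W)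
    (hS : c * Module.finrank ℂ W ≤ (LinearMap.trace ℂ W S).re) :
    ∃ (μ : ℂ) (w : W), w ≠ 0 ∧ S w = μ • w ∧ c ≤ ‖μ‖ := by
  by_contra! H
  have hs : S.charpoly.Splits := IsAlgClosed.splits _
  rw [Module.End.trace_eq_sum_roots_charpoly_of_splits hs] at hS
  have hcard : Multiset.card S.charpoly.roots = Module.finrank ℂ W := by
    rw [← LinearMap.charpoly_natDegree S]
    exact (hs.natDegree_eq_card_roots).symm
  have hroot : ∀ μ ∈ S.charpoly.roots, μ.re < c := by
    intro μ hμ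
    have h1 := (Polynomial.mem_roots'.1 hμ).2
    rw [← Module.End.hasEigenvalue_iff_isRoot_charpoly] at h1
    obtain ⟨w, hw⟩ := h1.exists_hasEigenvector
    exact lt_of_le_of_lt (Complex.re_le_norm _) (H μ w hw.2 hw.apply_eq_smul)
  have hre : (S.charpoly.roots.sum).re = (S.charpoly.roots.map Complex.re).sum := by
    have := map_multiset_sum Complex.reAddGroupHom S.charpoly.roots
    simpa using this
  have hne : S.charpoly.roots ≠ ∅ := by
    intro h0
    rw [h0] at hcard
    simp at hcard
    omega
  have h2 := Multiset.sum_lt_sum_of_nonempty (f := Complex.re) (g := fun _ => c) hne hroot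
  rw [hre] at hS
  simp [hcard] at h2
  linarith

lemma exists_eig_of_idem {V : Type*} [AddCommGroup V] [Module ℂ V] [FiniteDimensional ℂ V]
    (T e : Module.End ℂ V) (he : e * e = e) (he0 : e ≠ 0) (hT : T * e = T ∨ e * T = T)
    (c : ℝ) (hc : 0 < c)
    (htr : c * (LinearMap.trace ℂ V e).re ≤ (LinearMap.trace ℂ V T).re) :
    ∃ (μ : ℂ) (w : V), w ≠ 0 ∧ T w = μ • w ∧ c ≤ ‖μ‖ := by
  have hproj : LinearMap.IsProj (LinearMap.range e) e :=
    ⟨fun x => ⟨x, rfl⟩, by rintro _ ⟨y, rfl⟩; exact LinearMap.congr_fun he y⟩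
  have hr := hproj.trace
  have hTe : LinearMap.trace ℂ V T = LinearMap.trace ℂ V (T * e) := by
    rcases hT with h | h
    · rw [h]
    · rw [LinearMap.trace_mul_comm, h]
  set S : Module.End ℂ (LinearMap.range e) :=
    e.rangeRestrict ∘ₗ (T ∘ₗ (LinearMap.range e).subtype) with hSdef
  have hS : LinearMap.trace ℂ _ S = LinearMap.trace ℂ V T := by
    rw [hTe, hSdef, LinearMap.trace_comp_comm']
    rfl
  have hpos : 0 < Module.finrank ℂ (LinearMap.range e) := by
    rw [Module.finrank_pos_iff, Submodule.nontrivial_iff_ne_bot]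
    intro h
    exact he0 (LinearMap.range_eq_bot.1 h)
  obtain ⟨μ, w, hw, hSw, hμ⟩ := exists_eig S c hpos (by
    rw [hS]; rw [hr] at htr; simpa using htr)
  have h1 : e (T (w : V)) = μ • (w : V) := congrArg Subtype.val hSw
  have hμ0 : μ ≠ 0 := by
    rintro rfl
    simp at hμ; linarith
  have hw0 : (w : V) ≠ 0 := by simpa using hw
  rcases hT with h | h
  · refine ⟨μ, T w, ?_, ?_, hμ⟩
    · intro h0
      rw [h0, map_zero] at h1
      exact (smul_ne_zero hμ0 hw0) h1.symm
    · calc T (T (w : V)) = (T * e) (T (w : V)) := by rw [h]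
        _ = T (e (T (w : V))) := rfl
        _ = _ := by rw [h1, map_smul]
  · refine ⟨μ, w, hw0, ?_, hμ⟩
    rw [← h1]
    exact (LinearMap.congr_fun h w).symm

lemma zpow_act {V : Type*} [AddCommGroup V] [Module ℂ V] (U : (Module.End ℂ V)ˣ) (v w : V) (c : ℂ)
    (hv : U • v = v) (hw : U • w = w + c • v) (n : ℤ) (p q : ℂ) :
    U ^ n • (p • v + q • w) = (p + n * c * q) • v + q • w := by
  have hv' : U⁻¹ • v = v := by rw [inv_smul_eq_iff, hv]
  have hw' : U⁻¹ • w = w + (-c) • v := by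
    rw [inv_smul_eq_iff, smul_add, smul_comm, hv, hw]; module
  induction n generalizing p q with
  | zero => simp
  | succ i ih =>
    rw [zpow_add_one, mul_smul, smul_add, smul_comm U, smul_comm U, hv, hw]
    have := ih (p + c * q) q
    convert this using 2
    · module
    · push_cast; ring_nf
  | pred i ih =>
    rw [zpow_sub_one, mul_smul, smul_add, smul_comm U⁻¹, smul_comm U⁻¹, hv', hw']
    have := ih (p - c * q) q
    convert this using 2
    · module
    · push_cast; ring_nf

lemma isFreePair_of_eig {V : Type*} [AddCommGroup V] [Module ℂ V]
    (U₁ U₂ : (Module.End ℂ V)ˣ) (A B : Module.End ℂ V) (h1 : (U₁ : Module.End ℂ V) = 1 + A)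
    (h2 : (U₂ : Module.End ℂ V) = 1 + B) (hA : A * A = 0) (hB : B * B = 0)
    (μ : ℂ) (hμ : 4 ≤ ‖μ‖) (v : V) (hv : v ≠ 0) (hAB : A (B v) = μ • v) :
    IsFreePair U₁ U₂ := by
  have hμ0 : μ ≠ 0 := by rintro rfl; simp at hμ; linarith
  set w := B v with hw
  have hAv : A v = 0 := by
    have : A (μ • v) = 0 := by rw [← hAB]; exact LinearMap.congr_fun hA w
    rw [map_smul] at this
    exact (smul_eq_zero.1 this).resolve_left hμ0
  have hBw : B w = 0 := LinearMap.congr_fun hB v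
  have ind : ∀ p q : ℂ, p • v + q • w = 0 → p = 0 ∧ q = 0 := by
    intro p q h
    have e1 : A (p • v + q • w) = 0 := by rw [h, map_zero]
    rw [map_add, map_smul, map_smul, hAv, hAB, smul_zero, zero_add, smul_smul] at e1
    have hq : q = 0 := by
      have := (smul_eq_zero.1 e1).resolve_right hv
      exact (mul_eq_zero.1 this).resolve_right hμ0
    subst hq
    simp at h
    exact ⟨h.resolve_right hv, rfl⟩
  have a1 : U₁ • v = v := by
    rw [Units.smul_def, h1]; simp [hAv]
  have a2 : U₁ • w = w + μ • v := by
    rw [Units.smul_def, h1]; simp [hAB]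
  have b1 : U₂ • w = w := by
    rw [Units.smul_def, h2]; simp [hBw]
  have b2 : U₂ • v = v + (1 : ℂ) • w := by
    rw [Units.smul_def, h2]; simp [hw]
  unfold IsFreePair
  set a : Bool → (Module.End ℂ V)ˣ := fun b => if b then U₁ else U₂ with ha
  have hl : FreeGroup.lift a =
      (Monoid.CoprodI.lift fun i => FreeGroup.lift fun _ => a i).comp
        (@freeGroupEquivCoprodI Bool).toMonoidHom := by
    ext i
    simp [freeGroupEquivCoprodI]
  rw [hl, MonoidHom.coe_comp]
  refine Function.Injective.comp ?_ (MulEquiv.injective freeGroupEquivCoprodI)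
  let H : Bool → Type := fun _i => FreeGroup Unit
  let f : ∀ i, H i →* (Module.End ℂ V)ˣ := fun i => FreeGroup.lift fun _ => a i
  let X : Bool → Set V := fun b => if b then {x | ∃ p q : ℂ, x = p • v + q • w ∧ 2 * ‖q‖ < ‖p‖}
    else {x | ∃ p q : ℂ, x = p • v + q • w ∧ ‖p‖ < 2 * ‖q‖}
  have hdisj : Disjoint (X true) (X false) := by
    rw [Set.disjoint_left]
    rintro x ⟨p, q, hx, hpq⟩ ⟨p', q', hx', hpq'⟩
    have := ind (p - p') (q - q') (by
      have : p • v + q • w = p' • v + q' • w := by rw [← hx, hx']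
      rw [← sub_eq_zero] at this
      rw [← this]; module)
    rw [sub_eq_zero, sub_eq_zero] at this
    rw [this.1, this.2] at hpq
    linarith
  have hpow : ∀ i (h : H i), h ≠ 1 → ∃ n : ℤ, n ≠ 0 ∧ f i h = a i ^ n := by
    intro i h hne
    refine ⟨FreeGroup.freeGroupUnitEquivInt h, ?_, ?_⟩
    · intro h0
      apply hne
      apply FreeGroup.freeGroupUnitEquivInt.injective
      rw [h0]; rfl
    · have : h = FreeGroup.of () ^ (FreeGroup.freeGroupUnitEquivInt h) :=
        (FreeGroup.freeGroupUnitEquivInt.symm_apply_apply h).symm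
      conv_lhs => rw [this]
      rw [map_zpow]
      change (FreeGroup.lift (fun _ => a i)) (FreeGroup.of ()) ^ _ = _
      rw [FreeGroup.lift_apply_of]
  change Function.Injective (Monoid.CoprodI.lift f)
  have hint : ∀ n : ℤ, n ≠ 0 → (1 : ℝ) ≤ ‖(n : ℂ)‖ := by
    intro n hn
    rw [Complex.norm_intCast]
    exact_mod_cast Int.one_le_abs hn
  apply Monoid.CoprodI.lift_injective_of_ping_pong f _ X
  · intro i
    cases i
    · exact ⟨w, 0, 1, by simp, by simp⟩
    · exact ⟨v, 1, 0, by simp, by simp⟩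
  · intro i j hij
    cases i <;> cases j <;> first | exact absurd rfl hij | exact hdisj | exact hdisj.symm
  · intro i j hij h hne
    obtain ⟨n, hn, hfn⟩ := hpow i h hne
    rw [hfn]
    have hn1 := hint n hn
    rintro _ ⟨x, hx, rfl⟩
    cases i <;> cases j
    · exact absurd rfl hij
    · obtain ⟨p, q, rfl, hpq⟩ := hx
      refine ⟨p, q + n * p, ?_, ?_⟩
      · change U₂ ^ n • (p • v + q • w) = _
        rw [add_comm, zpow_act U₂ w v 1 b1 b2, add_comm]
        simp
      · have t1 : ‖(n : ℂ) * p‖ - ‖q‖ ≤ ‖q + n * p‖ := by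
          have := norm_sub_le (q + n * p) q
          rw [add_sub_cancel_left] at this
          linarith
        rw [norm_mul] at t1
        have t2 : ‖p‖ ≤ ‖(n : ℂ)‖ * ‖p‖ := le_mul_of_one_le_left (norm_nonneg _) hn1
        linarith
    · obtain ⟨p, q, rfl, hpq⟩ := hx
      refine ⟨p + n * μ * q, q, ?_, ?_⟩
      · exact zpow_act U₁ v w μ a1 a2 n p q
      · have t1 : ‖(n : ℂ) * μ * q‖ - ‖p‖ ≤ ‖p + n * μ * q‖ := by
          have := norm_sub_le (p + n * μ * q) p
          rw [add_sub_cancel_left] at this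
          linarith
        rw [norm_mul, norm_mul] at t1
        have t2 : 4 ≤ ‖(n : ℂ)‖ * ‖μ‖ := by nlinarith
        have t3 : 4 * ‖q‖ ≤ ‖(n : ℂ)‖ * ‖μ‖ * ‖q‖ :=
          mul_le_mul_of_nonneg_right t2 (norm_nonneg _)
        linarith
    · exact absurd rfl hij
  · right
    refine ⟨true, ?_⟩
    change 3 ≤ Cardinal.mk (FreeGroup Unit)
    rw [Cardinal.mk_congr FreeGroup.freeGroupUnitEquivInt, Cardinal.mk_denumerable]
    exact (Cardinal.natCast_lt_aleph0 (n := 3)).le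

section GroupRing

variable {G : Type*} [Group G]

/-- The left regular representation of the integral group ring over the complex numbers. -/
noncomputable def regRep (G : Type*) [Group G] :
    MonoidAlgebra ℤ G →+* Module.End ℂ (MonoidAlgebra ℂ G) :=
  (Algebra.lmul ℂ (MonoidAlgebra ℂ G)).toRingHom.comp
    (MonoidAlgebra.mapRingHom G (Int.castRingHom ℂ))

lemma trace_regRep [Fintype G] (u : MonoidAlgebra ℤ G) :
    LinearMap.trace ℂ _ (regRep G u) = (Fintype.card G : ℂ) * (u.coeff 1 : ℂ) := by
  classical
  induction u using MonoidAlgebra.induction_linear with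
  | zero => simp
  | add f g hf hg => rw [map_add, map_add, hf, hg]; simp; ring
  | single g n =>
    rw [LinearMap.trace_eq_matrix_trace ℂ (MonoidAlgebra.basis G ℂ), Matrix.trace]
    have : ∀ i : G, (LinearMap.toMatrix (MonoidAlgebra.basis G ℂ) (MonoidAlgebra.basis G ℂ)
        (regRep G (MonoidAlgebra.single g n))).diag i = if g = 1 then (n : ℂ) else 0 := by
      intro i
      rw [Matrix.diag_apply, LinearMap.toMatrix_apply]
      simp [regRep, MonoidAlgebra.basis, Finsupp.single_apply]
    simp only [this]
    by_cases hg : g = 1 <;> simp [hg, MonoidAlgebra.coeff_single]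

lemma coeff_one_mul_comm [Fintype G] (u v : MonoidAlgebra ℤ G) :
    (u * v).coeff 1 = (v * u).coeff 1 := by
  have h := LinearMap.trace_mul_comm ℂ (regRep G u) (regRep G v)
  rw [← map_mul, ← map_mul, trace_regRep, trace_regRep] at h
  have hc : (Fintype.card G : ℂ) ≠ 0 := by exact_mod_cast Fintype.card_ne_zero
  exact_mod_cast mul_left_cancel₀ hc h

lemma hat_mul_of (k : G) : hat k * MonoidAlgebra.of ℤ G k = hat k := by
  have := geom_sum_mul (MonoidAlgebra.of ℤ G k) (orderOf k)
  rw [← map_pow, pow_orderOf_eq_one, map_one, sub_self] at this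
  rw [mul_sub, mul_one, sub_eq_zero] at this
  exact this

lemma of_mul_hat (k : G) : MonoidAlgebra.of ℤ G k * hat k = hat k := by
  have := mul_geom_sum (MonoidAlgebra.of ℤ G k) (orderOf k)
  rw [← map_pow, pow_orderOf_eq_one, map_one, sub_self] at this
  rw [sub_mul, one_mul, sub_eq_zero] at this
  exact this

lemma mul_hat_of_fixed (k : G) (T : MonoidAlgebra ℤ G) (h : T * MonoidAlgebra.of ℤ G k = T) :
    T * hat k = (orderOf k : ℤ) • T := by
  have : ∀ i : ℕ, T * MonoidAlgebra.of ℤ G k ^ i = T := by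
    intro i
    induction i with
    | zero => simp
    | succ n ih => rw [pow_succ, ← mul_assoc, ih, h]
  rw [hat, Finset.mul_sum, Finset.sum_congr rfl (fun i _ => this i)]
  simp

lemma hat_mul_of_fixed (k : G) (T : MonoidAlgebra ℤ G) (h : MonoidAlgebra.of ℤ G k * T = T) :
    hat k * T = (orderOf k : ℤ) • T := by
  have : ∀ i : ℕ, MonoidAlgebra.of ℤ G k ^ i * T = T := by
    intro i
    induction i with
    | zero => simp
    | succ n ih => rw [pow_succ, mul_assoc, h, ih]
  rw [hat, Finset.sum_mul, Finset.sum_congr rfl (fun i _ => this i)]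
  simp

lemma hat_mul_hat (k : G) : hat k * hat k = (orderOf k : ℤ) • hat k :=
  mul_hat_of_fixed k _ (hat_mul_of k)

lemma hat_eq (k : G) : hat k = ∑ i ∈ Finset.range (orderOf k), MonoidAlgebra.of ℤ G (k ^ i) := by
  simp only [hat, map_pow]

lemma coeff_of_one_nonneg (g : G) : 0 ≤ (MonoidAlgebra.of ℤ G g).coeff 1 := by
  classical
  rw [MonoidAlgebra.of_apply, MonoidAlgebra.coeff_single, Finsupp.single_apply]
  split_ifs <;> simp

lemma coeff_of_one_ne (g : G) (hg : g ≠ 1) : (MonoidAlgebra.of ℤ G g).coeff 1 = 0 := by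
  classical
  rw [MonoidAlgebra.of_apply, MonoidAlgebra.coeff_single, Finsupp.single_apply, if_neg hg]

lemma coeff_hat_mul_of_nonneg (k t : G) : 0 ≤ (hat k * MonoidAlgebra.of ℤ G t).coeff 1 := by
  rw [hat_eq, Finset.sum_mul, MonoidAlgebra.coeff_sum, Finsupp.finsetSum_apply]
  refine Finset.sum_nonneg fun i _ => ?_
  rw [← map_mul]
  exact coeff_of_one_nonneg _

lemma coeff_hat_mul_nonneg (k s t : G) :
    0 ≤ (hat k * MonoidAlgebra.of ℤ G s * hat k * MonoidAlgebra.of ℤ G t).coeff 1 := by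
  rw [hat_eq]
  simp only [Finset.sum_mul, Finset.mul_sum, MonoidAlgebra.coeff_sum, Finsupp.finsetSum_apply,
    ← map_mul]
  exact Finset.sum_nonneg fun i _ => Finset.sum_nonneg fun j _ => coeff_of_one_nonneg _

lemma coeff_hat_mul_of_eq_zero (k s : G) (hs : s ∉ Subgroup.zpowers k) :
    (hat k * MonoidAlgebra.of ℤ G s).coeff 1 = 0 := by
  rw [hat_eq, Finset.sum_mul, MonoidAlgebra.coeff_sum, Finsupp.finsetSum_apply]
  refine Finset.sum_eq_zero fun i _ => ?_
  rw [← map_mul]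
  apply coeff_of_one_ne
  intro h
  apply hs
  rw [← inv_eq_of_mul_eq_one_right h]
  exact inv_mem (pow_mem (Subgroup.mem_zpowers k) i)

lemma coeff_hat [Fintype G] (k : G) : (hat k).coeff 1 = 1 := by
  rw [hat_eq, MonoidAlgebra.coeff_sum, Finsupp.finsetSum_apply,
    Finset.sum_eq_single_of_mem 0 (Finset.mem_range.2 (orderOf_pos k))]
  · simp
  · intro i hi h0
    apply coeff_of_one_ne
    exact pow_ne_one_of_lt_orderOf h0 (Finset.mem_range.1 hi)

lemma coeff_bound_one [Fintype G] (k s t : G) (hs : s ∉ Subgroup.zpowers k)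
    (ht : t ∉ Subgroup.zpowers k) :
    (orderOf k : ℤ) ≤ (hat k * (1 - MonoidAlgebra.of ℤ G s) * hat k *
      (1 - MonoidAlgebra.of ℤ G t)).coeff 1 := by
  have e : hat k * (1 - MonoidAlgebra.of ℤ G s) * hat k * (1 - MonoidAlgebra.of ℤ G t)
      = hat k * hat k - hat k * hat k * MonoidAlgebra.of ℤ G t
        - (hat k * MonoidAlgebra.of ℤ G s) * hat k
        + hat k * MonoidAlgebra.of ℤ G s * hat k * MonoidAlgebra.of ℤ G t := by noncomm_ring
  have h1 : (hat k * MonoidAlgebra.of ℤ G s * hat k).coeff 1 = 0 := by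
    rw [coeff_one_mul_comm, ← mul_assoc, hat_mul_hat, smul_mul_assoc,
      MonoidAlgebra.coeff_smul_apply, coeff_hat_mul_of_eq_zero k s hs, smul_zero]
  have h2 : (hat k * hat k * MonoidAlgebra.of ℤ G t).coeff 1 = 0 := by
    rw [hat_mul_hat, smul_mul_assoc,
      MonoidAlgebra.coeff_smul_apply, coeff_hat_mul_of_eq_zero k t ht, smul_zero]
  have h3 : (hat k * hat k).coeff 1 = orderOf k := by
    rw [hat_mul_hat, MonoidAlgebra.coeff_smul_apply, coeff_hat]; simp
  have h4 := coeff_hat_mul_nonneg k s t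
  rw [e, MonoidAlgebra.coeff_add, MonoidAlgebra.coeff_sub, MonoidAlgebra.coeff_sub,
    Finsupp.add_apply, Finsupp.sub_apply, Finsupp.sub_apply, h1, h2, h3]
  linarith

lemma coeff_bound_two [Fintype G] (k s : G) (hs : s ∉ Subgroup.zpowers k) :
    (orderOf k : ℤ) ≤ (hat k * ((1 - MonoidAlgebra.of ℤ G s) *
      (1 - MonoidAlgebra.of ℤ G s)) * hat k).coeff 1 := by
  have e : hat k * (hat k * ((1 - MonoidAlgebra.of ℤ G s) * (1 - MonoidAlgebra.of ℤ G s)))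
      = hat k * hat k * ((1 - MonoidAlgebra.of ℤ G s) * (1 - MonoidAlgebra.of ℤ G s)) := by
    noncomm_ring
  have e2 : hat k * ((1 - MonoidAlgebra.of ℤ G s) * (1 - MonoidAlgebra.of ℤ G s))
      = hat k - hat k * MonoidAlgebra.of ℤ G s - hat k * MonoidAlgebra.of ℤ G s
        + hat k * MonoidAlgebra.of ℤ G (s * s) := by rw [map_mul]; noncomm_ring
  have h1 := coeff_hat_mul_of_eq_zero k s hs
  have h2 := coeff_hat_mul_of_nonneg k (s * s)
  rw [coeff_one_mul_comm, e, hat_mul_hat, smul_mul_assoc, MonoidAlgebra.coeff_smul_apply, e2,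
    MonoidAlgebra.coeff_add, MonoidAlgebra.coeff_sub, MonoidAlgebra.coeff_sub,
    Finsupp.add_apply, Finsupp.sub_apply, Finsupp.sub_apply, h1, coeff_hat, smul_eq_mul]
  nlinarith [Int.natCast_nonneg (orderOf k)]

lemma two_le_orderOf [Fintype G] (k : G) (hk : k ≠ 1) : 2 ≤ orderOf k := by
  have h1 := orderOf_pos k
  have h2 : orderOf k ≠ 1 := fun h => hk (orderOf_eq_one_iff.1 h)
  omega

lemma isFreePair_core [Fintype G] (u v : (MonoidAlgebra ℤ G)ˣ) (a b T : MonoidAlgebra ℤ G) (k : G)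
    (hu : (u : MonoidAlgebra ℤ G) = 1 + a) (hv : (v : MonoidAlgebra ℤ G) = 1 + b)
    (ha : a * a = 0) (hb : b * b = 0) (hT : T = a * b ∨ T = b * a)
    (hk : k ≠ 1)
    (hTk : T * MonoidAlgebra.of ℤ G k = T ∨ MonoidAlgebra.of ℤ G k * T = T)
    (hcoeff : (orderOf k : ℤ) ≤ T.coeff 1) : IsFreePair u v := by
  have hk2 : (2 : ℝ) ≤ orderOf k := by exact_mod_cast two_le_orderOf k hk
  have hd0 : (orderOf k : ℂ) ≠ 0 := by exact_mod_cast (orderOf_pos k).ne'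
  have hG : (0 : ℝ) < Fintype.card G := by exact_mod_cast Fintype.card_pos
  have : FiniteDimensional ℂ (MonoidAlgebra ℂ G) :=
    Module.Finite.of_basis (MonoidAlgebra.basis G ℂ)
  set e : Module.End ℂ (MonoidAlgebra ℂ G) := (orderOf k : ℂ)⁻¹ • regRep G (hat k) with he
  have hzs : ∀ x : MonoidAlgebra ℤ G, regRep G ((orderOf k : ℤ) • x)
      = (orderOf k : ℂ) • regRep G x := by
    intro x
    rw [map_zsmul, ← Int.cast_smul_eq_zsmul ℂ, Int.cast_natCast]
  have hee : e * e = e := by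
    rw [he, smul_mul_smul_comm, ← map_mul, hat_mul_hat, hzs, smul_smul]
    congr 1
    field_simp
  have htre : LinearMap.trace ℂ _ e = ((Fintype.card G : ℝ) / (orderOf k : ℝ) : ℝ) := by
    rw [he, map_smul, trace_regRep, coeff_hat]
    push_cast
    simp; field_simp
  have he0 : e ≠ 0 := by
    intro h
    rw [h, map_zero] at htre
    have : (0 : ℝ) = (Fintype.card G : ℝ) / (orderOf k : ℝ) := by exact_mod_cast htre
    have h2 : 0 < (Fintype.card G : ℝ) / (orderOf k : ℝ) := by positivity
    linarith
  have hTe : regRep G T * e = regRep G T ∨ e * regRep G T = regRep G T := by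
    rcases hTk with h | h
    · left
      rw [he, mul_smul_comm, ← map_mul, mul_hat_of_fixed k T h, hzs, smul_smul,
        inv_mul_cancel₀ hd0, one_smul]
    · right
      rw [he, smul_mul_assoc, ← map_mul, hat_mul_of_fixed k T h, hzs, smul_smul,
        inv_mul_cancel₀ hd0, one_smul]
  have hcr : (orderOf k : ℝ) ≤ (T.coeff 1 : ℝ) := by exact_mod_cast hcoeff
  obtain ⟨μ, w, hw, hTw, hμ⟩ := exists_eig_of_idem (regRep G T) e hee he0 hTe 4 (by norm_num) (by
    rw [htre, trace_regRep, Complex.ofReal_re]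
    have : ((Fintype.card G : ℂ) * (T.coeff 1 : ℂ)) =
      (((Fintype.card G : ℝ) * (T.coeff 1 : ℝ) : ℝ) : ℂ) := by push_cast; rfl
    rw [this, Complex.ofReal_re, ← mul_div_assoc, div_le_iff₀ (by linarith), mul_assoc,
      mul_comm (4 : ℝ)]
    apply mul_le_mul_of_nonneg_left _ hG.le
    nlinarith)
  have hμ0 : μ ≠ 0 := by rintro rfl; simp at hμ; linarith
  have key : ∃ v : MonoidAlgebra ℂ G, v ≠ 0 ∧ regRep G a (regRep G b v) = μ • v := by
    rcases hT with h | h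
    · refine ⟨w, hw, ?_⟩
      rw [← hTw, h, map_mul]; rfl
    · rw [h, map_mul] at hTw
      change regRep G b (regRep G a w) = μ • w at hTw
      refine ⟨regRep G a w, ?_, ?_⟩
      · intro h0
        rw [h0, map_zero] at hTw
        exact smul_ne_zero hμ0 hw hTw.symm
      · rw [hTw, map_smul]
  obtain ⟨z, hz, hABz⟩ := key
  have hfree := isFreePair_of_eig (Units.map (regRep G).toMonoidHom u) (Units.map (regRep G).toMonoidHom v)
    (regRep G a) (regRep G b) (by simp [hu]) (by simp [hv])
    (by rw [← map_mul, ha, map_zero]) (by rw [← map_mul, hb, map_zero]) μ hμ z hz hABz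
  unfold IsFreePair at hfree ⊢
  have hcomp : (FreeGroup.lift (fun b : Bool => if b then Units.map (regRep G).toMonoidHom u
      else Units.map (regRep G).toMonoidHom v)) =
      (Units.map (regRep G).toMonoidHom).comp (FreeGroup.lift (fun b : Bool => if b then u else v)) := by
    ext i
    cases i <;> simp
  rw [hcomp, MonoidHom.coe_comp] at hfree
  exact hfree.of_comp

end GroupRing

section Final

variable {G : Type*} [Group G]

lemma conj_mem_of_conj_inv_mem [Fintype G] (x h : G) (hx : x⁻¹ * h * x ∈ Subgroup.zpowers h) :
    x * h * x⁻¹ ∈ Subgroup.zpowers h := by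
  have key : ∀ n : ℕ, (x ^ n)⁻¹ * h * x ^ n ∈ Subgroup.zpowers h := by
    intro n
    induction n with
    | zero => simp
    | succ n ih =>
      obtain ⟨j, hj⟩ := Subgroup.mem_zpowers_iff.1 ih
      have e : (x ^ (n + 1))⁻¹ * h * x ^ (n + 1) = (x⁻¹ * h * x) ^ j := by
        have := conj_zpow (a := x⁻¹) (b := h) (i := j)
        rw [inv_inv] at this
        rw [this, hj, pow_succ]
        group
      rw [e]
      exact zpow_mem hx j
  have h1 := key (orderOf x - 1)
  have h2 : x ^ (orderOf x - 1) = x⁻¹ := by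
    apply eq_inv_of_mul_eq_one_left
    rw [← pow_succ, Nat.sub_add_cancel (orderOf_pos x), pow_orderOf_eq_one]
  rw [h2, inv_inv] at h1
  exact h1

lemma of_mul_hat_of_mem [Fintype G] (h s : G) (hs : s ∈ Subgroup.zpowers h) :
    MonoidAlgebra.of ℤ G s * hat h = hat h ∧ hat h * MonoidAlgebra.of ℤ G s = hat h := by
  obtain ⟨n, rfl⟩ := (mem_powers_iff_mem_zpowers (x := h)).2 hs
  simp only
  constructor
  · induction n with
    | zero => rw [pow_zero, map_one]; simp only [one_mul, mul_one]
    | succ n ih => rw [pow_succ, map_mul, mul_assoc, of_mul_hat, ih (pow_mem (Subgroup.mem_zpowers h) n)]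
  · induction n with
    | zero => rw [pow_zero, map_one]; simp only [one_mul, mul_one]
    | succ n ih =>
      rw [pow_succ, map_mul, ← mul_assoc, ih (pow_mem (Subgroup.mem_zpowers h) n), hat_mul_of]

lemma hat_conj (x h : G) :
    hat (x * h * x⁻¹) * MonoidAlgebra.of ℤ G x = MonoidAlgebra.of ℤ G x * hat h := by
  have ho : orderOf (x * h * x⁻¹) = orderOf h := by
    have := orderOf_injective (MulAut.conj x).toMonoidHom (MulAut.conj x).injective h
    simpa using this
  rw [hat_eq, hat_eq, ho, Finset.sum_mul, Finset.mul_sum]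
  refine Finset.sum_congr rfl fun i _ => ?_
  rw [← map_mul, ← map_mul, conj_pow]
  simp

/-- the nilpotent part of a bicyclic unit of type beta -/
noncomputable def nb (x h : G) : MonoidAlgebra ℤ G :=
  (1 - MonoidAlgebra.of ℤ G h) * MonoidAlgebra.of ℤ G x * hat h

/-- the nilpotent part of a bicyclic unit of type gamma -/
noncomputable def ng (x h : G) : MonoidAlgebra ℤ G :=
  hat h * MonoidAlgebra.of ℤ G x * (1 - MonoidAlgebra.of ℤ G h)

lemma hat_mul_one_sub (h : G) : hat h * (1 - MonoidAlgebra.of ℤ G h) = 0 := by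
  rw [mul_sub, mul_one, hat_mul_of, sub_self]

lemma one_sub_mul_hat (h : G) : (1 - MonoidAlgebra.of ℤ G h) * hat h = 0 := by
  rw [sub_mul, one_mul, of_mul_hat, sub_self]

lemma nb_sq (x h : G) : nb x h * nb x h = 0 := by
  have : nb x h * nb x h = (1 - MonoidAlgebra.of ℤ G h) * MonoidAlgebra.of ℤ G x *
    (hat h * (1 - MonoidAlgebra.of ℤ G h)) * MonoidAlgebra.of ℤ G x * hat h := by
    simp only [nb, mul_assoc]
  rw [this, hat_mul_one_sub]; simp

lemma ng_sq (x h : G) : ng x h * ng x h = 0 := by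
  have : ng x h * ng x h = hat h * MonoidAlgebra.of ℤ G x *
    ((1 - MonoidAlgebra.of ℤ G h) * hat h) * MonoidAlgebra.of ℤ G x *
      (1 - MonoidAlgebra.of ℤ G h) := by
    simp only [ng, mul_assoc]
  rw [this, one_sub_mul_hat]; simp

lemma exists_unit (b : MonoidAlgebra ℤ G) (hb : b * b = 0) :
    ∃ u : (MonoidAlgebra ℤ G)ˣ, (u : MonoidAlgebra ℤ G) = 1 + b :=
  ⟨⟨1 + b, 1 - b, by noncomm_ring; simp [hb], by noncomm_ring; simp [hb]⟩, rfl⟩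

lemma one_sub_conj (x h : G) :
    MonoidAlgebra.of ℤ G x * (1 - MonoidAlgebra.of ℤ G h) =
      (1 - MonoidAlgebra.of ℤ G (x * h * x⁻¹)) * MonoidAlgebra.of ℤ G x := by
  rw [mul_sub, sub_mul, ← map_mul, ← map_mul]
  simp

lemma of_mul_of_inv (x : G) : MonoidAlgebra.of ℤ G x * MonoidAlgebra.of ℤ G x⁻¹ = 1 := by
  rw [← map_mul, mul_inv_cancel, map_one]

lemma of_inv_mul_of (x : G) : MonoidAlgebra.of ℤ G x⁻¹ * MonoidAlgebra.of ℤ G x = 1 := by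
  rw [← map_mul, inv_mul_cancel, map_one]

lemma nb_ne (x h : G) [Fintype G] (hne : nb x h ≠ 0) : x⁻¹ * h * x ∉ Subgroup.zpowers h := by
  intro hm
  apply hne
  have := one_sub_conj x (x⁻¹ * h * x)
  have e : x * (x⁻¹ * h * x) * x⁻¹ = h := by group
  rw [e] at this
  rw [nb, ← this, mul_assoc, sub_mul, (of_mul_hat_of_mem h _ hm).1, one_mul, sub_self, mul_zero]

lemma ng_ne (x h : G) [Fintype G] (hne : ng x h ≠ 0) : x * h * x⁻¹ ∉ Subgroup.zpowers h := by
  intro hm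
  apply hne
  rw [ng, mul_assoc, one_sub_conj, ← mul_assoc, mul_sub, (of_mul_hat_of_mem h _ hm).2, mul_one,
    sub_self, zero_mul]

lemma conj_notMem [Fintype G] (x h : G) (hm : x * h * x⁻¹ ∉ Subgroup.zpowers h) :
    x⁻¹ * h * x ∉ Subgroup.zpowers h := fun h' => hm (conj_mem_of_conj_inv_mem x h h')

lemma conj_notMem' [Fintype G] (x h : G) (hm : x⁻¹ * h * x ∉ Subgroup.zpowers h) :
    x * h * x⁻¹ ∉ Subgroup.zpowers h := fun h' => hm (by
  have := conj_mem_of_conj_inv_mem x⁻¹ h (by rwa [inv_inv])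
  rwa [inv_inv] at this)

/-- If conjugation by `x` moves `h` out of its cyclic group then the same holds for the
conjugate of `h`. -/
lemma conj_conj_notMem (x h : G) (hm : x * h * x⁻¹ ∉ Subgroup.zpowers h) :
    x * (x * h * x⁻¹) * x⁻¹ ∉ Subgroup.zpowers (x * h * x⁻¹) := by
  intro h'
  obtain ⟨j, hj⟩ := Subgroup.mem_zpowers_iff.1 h'
  apply hm
  rw [conj_zpow] at hj
  have : h ^ j = x * h * x⁻¹ := by
    have := congrArg (fun g => x⁻¹ * g * x) hj
    simpa [mul_assoc] using this
  exact Subgroup.mem_zpowers_iff.2 ⟨j, this⟩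

lemma self_notMem (x h : G) (hm : x⁻¹ * h * x ∉ Subgroup.zpowers h) :
    h ∉ Subgroup.zpowers (x * h * x⁻¹) := by
  intro h'
  obtain ⟨j, hj⟩ := Subgroup.mem_zpowers_iff.1 h'
  apply hm
  rw [conj_zpow] at hj
  have : h ^ j = x⁻¹ * h * x := by
    have := congrArg (fun g => x⁻¹ * g * x) hj
    simpa [mul_assoc] using this
  exact Subgroup.mem_zpowers_iff.2 ⟨j, this⟩

lemma ne_one_of_conj (x h : G) (hm : x⁻¹ * h * x ∉ Subgroup.zpowers h) : h ≠ 1 := by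
  rintro rfl
  simp at hm

lemma free_bb [Fintype G] (x h : G) (hm : x⁻¹ * h * x ∉ Subgroup.zpowers h)
    (u v : (MonoidAlgebra ℤ G)ˣ) (hu : (u : MonoidAlgebra ℤ G) = 1 + nb x h)
    (hv : (v : MonoidAlgebra ℤ G) = 1 + nb x⁻¹ (x * h * x⁻¹)) : IsFreePair u v := by
  refine isFreePair_core u v _ _ _ (x * h * x⁻¹) hu hv (nb_sq _ _) (nb_sq _ _) (Or.inl rfl) ?_
    (Or.inl ?_) ?_
  · intro h0
    apply ne_one_of_conj x h hm
    simpa using h0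
  · simp only [nb, mul_assoc]
    rw [hat_mul_of]
  · set k := x * h * x⁻¹ with hk
    have e : nb x h * nb x⁻¹ k = (1 - MonoidAlgebra.of ℤ G h) *
        (hat k * (1 - MonoidAlgebra.of ℤ G (x * k * x⁻¹)) * hat k) := by
      calc nb x h * nb x⁻¹ k = (1 - MonoidAlgebra.of ℤ G h) * ((MonoidAlgebra.of ℤ G x * hat h) *
            (1 - MonoidAlgebra.of ℤ G k) * MonoidAlgebra.of ℤ G x⁻¹ * hat k) := by
            simp only [nb, mul_assoc]
        _ = (1 - MonoidAlgebra.of ℤ G h) * (hat k * (MonoidAlgebra.of ℤ G x *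
            (1 - MonoidAlgebra.of ℤ G k)) * MonoidAlgebra.of ℤ G x⁻¹ * hat k) := by
            rw [← hat_conj, ← hk]; simp only [mul_assoc]
        _ = (1 - MonoidAlgebra.of ℤ G h) * (hat k * (1 - MonoidAlgebra.of ℤ G (x * k * x⁻¹)) *
            (MonoidAlgebra.of ℤ G x * MonoidAlgebra.of ℤ G x⁻¹) * hat k) := by
            rw [one_sub_conj]; simp only [mul_assoc]
        _ = _ := by rw [of_mul_of_inv, mul_one]
    rw [e, coeff_one_mul_comm]
    exact coeff_bound_one k _ _ (conj_conj_notMem x h (conj_notMem' x h hm)) (self_notMem x h hm)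

lemma free_gg [Fintype G] (x h : G) (hm : x * h * x⁻¹ ∉ Subgroup.zpowers h)
    (u v : (MonoidAlgebra ℤ G)ˣ) (hu : (u : MonoidAlgebra ℤ G) = 1 + ng x h)
    (hv : (v : MonoidAlgebra ℤ G) = 1 + ng x⁻¹ (x⁻¹ * h * x)) : IsFreePair u v := by
  have hm' := conj_notMem x h hm
  refine isFreePair_core u v _ _ _ (x⁻¹ * h * x) hu hv (ng_sq _ _) (ng_sq _ _) (Or.inr rfl) ?_
    (Or.inr ?_) ?_
  · intro h0
    apply ne_one_of_conj x h hm'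
    have := congrArg (fun g => x * g * x⁻¹) h0
    simpa [mul_assoc] using this
  · simp only [ng, ← mul_assoc]
    rw [of_mul_hat]
  · set k := x⁻¹ * h * x with hk
    have hh : x * k * x⁻¹ = h := by rw [hk]; group
    have e : ng x⁻¹ k * ng x h = hat k * (1 - MonoidAlgebra.of ℤ G (x⁻¹ * k * x⁻¹⁻¹)) * hat k *
        (1 - MonoidAlgebra.of ℤ G h) := by
      calc ng x⁻¹ k * ng x h = hat k * (MonoidAlgebra.of ℤ G x⁻¹ * (1 - MonoidAlgebra.of ℤ G k)) *
            (hat h * MonoidAlgebra.of ℤ G x) * (1 - MonoidAlgebra.of ℤ G h) := by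
            simp only [ng, mul_assoc]
        _ = hat k * (1 - MonoidAlgebra.of ℤ G (x⁻¹ * k * x⁻¹⁻¹)) *
            (MonoidAlgebra.of ℤ G x⁻¹ * MonoidAlgebra.of ℤ G x) * hat k *
            (1 - MonoidAlgebra.of ℤ G h) := by
            have := hat_conj x k
            rw [hh] at this
            rw [one_sub_conj, this]; simp only [mul_assoc]
        _ = _ := by rw [of_inv_mul_of, mul_one]
    rw [e]
    have q1 := conj_conj_notMem x⁻¹ h (by rwa [inv_inv])
    have q2 := self_notMem x⁻¹ h (by rwa [inv_inv])
    rw [inv_inv] at q1 q2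
    rw [inv_inv]
    exact coeff_bound_one k _ _ q1 q2

lemma free_bg [Fintype G] (x h : G) (hm : x⁻¹ * h * x ∉ Subgroup.zpowers h)
    (u v : (MonoidAlgebra ℤ G)ˣ)
    (huv : ((u : MonoidAlgebra ℤ G) = 1 + nb x h ∧ (v : MonoidAlgebra ℤ G) = 1 + ng x⁻¹ h) ∨
      ((v : MonoidAlgebra ℤ G) = 1 + nb x h ∧ (u : MonoidAlgebra ℤ G) = 1 + ng x⁻¹ h)) :
    IsFreePair u v := by
  have h1 := ne_one_of_conj x h hm
  have h2 : (ng x⁻¹ h * nb x h) * MonoidAlgebra.of ℤ G h = ng x⁻¹ h * nb x h := by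
    rw [nb, mul_assoc, mul_assoc _ (hat _), hat_mul_of]
  have h3 : (orderOf h : ℤ) ≤ (ng x⁻¹ h * nb x h).coeff 1 := by
    have e : ng x⁻¹ h * nb x h = hat h * ((1 - MonoidAlgebra.of ℤ G (x⁻¹ * h * x⁻¹⁻¹)) *
        (1 - MonoidAlgebra.of ℤ G (x⁻¹ * h * x⁻¹⁻¹))) * hat h := by
      calc ng x⁻¹ h * nb x h = hat h * ((MonoidAlgebra.of ℤ G x⁻¹ * (1 - MonoidAlgebra.of ℤ G h)) *
            (1 - MonoidAlgebra.of ℤ G h)) * MonoidAlgebra.of ℤ G x * hat h := by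
            simp only [ng, nb, mul_assoc]
        _ = hat h * ((1 - MonoidAlgebra.of ℤ G (x⁻¹ * h * x⁻¹⁻¹)) *
            (MonoidAlgebra.of ℤ G x⁻¹ * (1 - MonoidAlgebra.of ℤ G h))) *
              MonoidAlgebra.of ℤ G x * hat h := by
            rw [one_sub_conj]; simp only [mul_assoc]
            rw [← mul_assoc (MonoidAlgebra.of ℤ G x⁻¹), one_sub_conj]; simp only [mul_assoc]
        _ = hat h * ((1 - MonoidAlgebra.of ℤ G (x⁻¹ * h * x⁻¹⁻¹)) *
              (1 - MonoidAlgebra.of ℤ G (x⁻¹ * h * x⁻¹⁻¹))) *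
              (MonoidAlgebra.of ℤ G x⁻¹ * MonoidAlgebra.of ℤ G x) * hat h := by
            rw [one_sub_conj]; simp only [mul_assoc]
        _ = _ := by rw [of_inv_mul_of, mul_one]
    rw [e]
    rw [inv_inv]
    exact coeff_bound_two h _ hm
  rcases huv with ⟨hu, hv⟩ | ⟨hv, hu⟩
  · exact isFreePair_core u v _ _ _ h hu hv (nb_sq _ _) (ng_sq _ _) (Or.inr rfl) h1 (Or.inl h2) h3
  · exact isFreePair_core u v _ _ _ h hu hv (ng_sq _ _) (nb_sq _ _) (Or.inl rfl) h1 (Or.inl h2) h3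

end Final

/-- **Theorem 2.** If `α` is a non-trivial bicyclic unit of `ℤG` (`G` a finite group), then
there are bicyclic units `β` (of type `β`) and `γ` (of type `γ`) — hence of different types —
such that `(α, β)` and `(α, γ)` are free pairs in the unit group of `ℤG`. -/
theorem free_companions_of_bicyclic (G : Type*) [Group G] [Fintype G]
    (α : (MonoidAlgebra ℤ G)ˣ) (hα : IsBicyclicUnit (α : MonoidAlgebra ℤ G)) (hα1 : α ≠ 1) :
    ∃ (x₁ h₁ x₂ h₂ : G) (β γ : (MonoidAlgebra ℤ G)ˣ),
      (β : MonoidAlgebra ℤ G) = bicyclicBeta x₁ h₁ ∧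
      (γ : MonoidAlgebra ℤ G) = bicyclicGamma x₂ h₂ ∧
      IsFreePair α β ∧ IsFreePair α γ := by
  have hne : (α : MonoidAlgebra ℤ G) ≠ 1 := fun h => hα1 (Units.ext h)
  obtain ⟨x, h, hb | hg⟩ := hα
  · have hm := nb_ne x h (fun h0 => hne (by rw [hb]; change 1 + nb x h = 1; rw [h0, add_zero]))
    obtain ⟨β, hβ⟩ := exists_unit _ (nb_sq x⁻¹ (x * h * x⁻¹))
    obtain ⟨γ, hγ⟩ := exists_unit _ (ng_sq x⁻¹ h)
    exact ⟨_, _, _, _, β, γ, hβ, hγ, free_bb x h hm α β hb hβ, free_bg x h hm α γ (Or.inl ⟨hb, hγ⟩)⟩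
  · have hm := ng_ne x h (fun h0 => hne (by rw [hg]; change 1 + ng x h = 1; rw [h0, add_zero]))
    obtain ⟨γ, hγ⟩ := exists_unit _ (ng_sq x⁻¹ (x⁻¹ * h * x))
    obtain ⟨β, hβ⟩ := exists_unit _ (nb_sq x⁻¹ h)
    exact ⟨_, _, _, _, β, γ, hβ, hγ, free_bg x⁻¹ h (by rwa [inv_inv]) α β
      (Or.inr ⟨hβ, by rw [inv_inv]; exact hg⟩), free_gg x h hm α γ hg hγ⟩
end

section
/- Let R be a ring of characteristic 0 embedded in a ℂ-algebra (e.g. in ℂ ⊗_ℤ R), and let a, b ∈ R with a² = b² = 0; set α = 1+a and β = 1+b. If m and n are positive integers, then (α^m, β^n) is a free pair if and only if (α, β^{mn}) is a free pair. -/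
theorem fp_cyc (H : Subgroup (FreeGroup Bool))
    (hH : ∀ x ∈ H, ∀ y ∈ H, ∀ z ∈ H, Commute (x * y * x⁻¹ * y⁻¹) z) :
    ∃ v ∈ H, ∀ h ∈ H, ∃ n : ℤ, v ^ n = h := by
  classical
  have hs : Subsingleton (IsFreeGroup.Generators H) := by
    refine ⟨fun i j => ?_⟩
    by_contra hij
    let φ : H →* Equiv.Perm (Fin 3) :=
      IsFreeGroup.lift (fun t => if t = i then Equiv.swap 0 1 else Equiv.swap 1 2)
    have h1 : φ (IsFreeGroup.of i) = Equiv.swap 0 1 := by simp [φ]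
    have h2 : φ (IsFreeGroup.of j) = Equiv.swap 1 2 := by simp [φ, Ne.symm hij]
    set p : H := IsFreeGroup.of i
    set q : H := IsFreeGroup.of j
    have h3 : (p * q * p⁻¹ * q⁻¹) * p = p * (p * q * p⁻¹ * q⁻¹) := by
      apply Subtype.ext
      exact hH _ p.2 _ q.2 _ p.2
    have h4 := congrArg φ h3
    simp only [map_mul, map_inv, h1, h2] at h4
    revert h4
    decide
  have hc : IsCyclic H := by
    rcases isEmpty_or_nonempty (IsFreeGroup.Generators H) with h | ⟨⟨g⟩⟩
    · have : Subsingleton H := (IsFreeGroup.toFreeGroup H).toEquiv.subsingleton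
      infer_instance
    · let _ : Unique (IsFreeGroup.Generators H) := ⟨⟨g⟩, fun x => Subsingleton.elim _ _⟩
      exact isCyclic_of_surjective (IsFreeGroup.toFreeGroup H).symm
        (IsFreeGroup.toFreeGroup H).symm.surjective
  obtain ⟨v, hv⟩ := hc.exists_zpow_surjective
  refine ⟨v, v.2, fun h hh => ?_⟩
  obtain ⟨n, hn⟩ := hv ⟨h, hh⟩
  exact ⟨n, by simpa using congrArg Subtype.val hn⟩

theorem fp_comm (u v : FreeGroup Bool) (h : Commute u v) (hu : u ≠ 1) (hv : v ≠ 1) :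
    ∃ i j : ℤ, i ≠ 0 ∧ j ≠ 0 ∧ u ^ i = v ^ j := by
  let H : Subgroup (FreeGroup Bool) := Subgroup.closure {u, v}
  have hcomm : ∀ x ∈ H, ∀ y ∈ H, x * y = y * x := by
    intro x hx y hy
    have : IsMulCommutative H := by
      apply Subgroup.isMulCommutative_closure
      rintro a (rfl | rfl) b (rfl | rfl)
      · rfl
      · exact h
      · exact h.symm
      · rfl
    exact congrArg Subtype.val (this.is_comm.comm ⟨x, hx⟩ ⟨y, hy⟩)
  obtain ⟨g, -, hg⟩ := fp_cyc H (fun x hx y hy z hz => by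
    have e : x * y * x⁻¹ * y⁻¹ = 1 := by rw [hcomm x hx y hy]; group
    rw [e]
    exact Commute.one_left z)
  obtain ⟨i, hi⟩ := hg u (Subgroup.subset_closure (by simp))
  obtain ⟨j, hj⟩ := hg v (Subgroup.subset_closure (by simp))
  refine ⟨j, i, ?_, ?_, ?_⟩
  · rintro rfl; exact hv (by simpa using hj.symm)
  · rintro rfl; exact hu (by simpa using hi.symm)
  · rw [← hi, ← hj, ← zpow_mul, ← zpow_mul, mul_comm]

theorem fp_zpow {u : FreeGroup Bool} (hu : u ≠ 1) {i : ℤ} (h : u ^ i = 1) : i = 0 := by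
  by_contra hi
  exact hu (zpow_left_injective hi (by simpa using h))

theorem fp_indep {p q : ℤ} (h : (FreeGroup.of true) ^ p = (FreeGroup.of false) ^ q) : p = 0 := by
  have := congrArg (FreeGroup.lift (fun b : Bool => if b then Multiplicative.ofAdd (1:ℤ) else 1)) h
  simpa [← ofAdd_zsmul] using this

theorem fp_C (w : FreeGroup Bool) (k l : ℤ) (hk : k ≠ 0) (hl : l ≠ 0)
    (h1 : Commute w (FreeGroup.of true ^ k)) (h2 : Commute w (FreeGroup.of false ^ l)) :
    w = 1 := by
  by_contra hw
  obtain ⟨i, j, hi, hj, e1⟩ := fp_comm _ _ h1 hw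
    (fun h => hk (fp_zpow (FreeGroup.of_ne_one _) h))
  obtain ⟨i', j', hi', hj', e2⟩ := fp_comm _ _ h2 hw
    (fun h => hl (fp_zpow (FreeGroup.of_ne_one _) h))
  have : (FreeGroup.of true) ^ (k * j * i') = (FreeGroup.of false) ^ (l * j' * i) := by
    rw [zpow_mul, zpow_mul, ← e1, zpow_mul, zpow_mul, ← e2, ← zpow_mul, ← zpow_mul, mul_comm]
  have := fp_indep this
  simp_all

theorem fp_conj_sq (v x : FreeGroup Bool) (hv : v ≠ 1) (k l : ℤ) (h1 : v ^ k = x * v * x⁻¹)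
    (h2 : v ^ l = x⁻¹ * v * x) : Commute v (x ^ (2 : ℤ)) := by
  have e : v ^ (k * l - 1) = 1 := by
    have : v ^ (k * l) = v := by
      have h3 : (x⁻¹ * v * x) ^ k = x⁻¹ * v ^ k * x := by
        simpa using (conj_zpow (i := k) (a := x⁻¹) (b := v))
      rw [mul_comm, zpow_mul, h2, h3, h1]; group
    rw [zpow_sub, this]; simp
  have e' := fp_zpow hv e
  have hkl : k * k = 1 := by
    rcases Int.eq_one_or_neg_one_of_mul_eq_one (show k * l = 1 by omega) with h | h <;> simp [h]
  have : x ^ 2 * v * (x ^ 2)⁻¹ = v := by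
    calc x ^ 2 * v * (x ^ 2)⁻¹ = x * (x * v * x⁻¹) * x⁻¹ := by rw [pow_two]; group
      _ = (x * v * x⁻¹) ^ k := by rw [conj_zpow, ← h1]
      _ = v := by rw [← h1, ← zpow_mul, hkl, zpow_one]
  have h4 : x ^ 2 * v = v * x ^ 2 := by
    rw [mul_inv_eq_iff_eq_mul] at this; exact this
  exact_mod_cast h4.symm

theorem fp_normal (N : Subgroup (FreeGroup Bool)) (hN : N.Normal)
    (hH : ∀ x ∈ N, ∀ y ∈ N, ∀ z ∈ N, Commute (x * y * x⁻¹ * y⁻¹) z) (w : FreeGroup Bool) (hw : w ∈ N) :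
    w = 1 := by
  obtain ⟨v, hvN, hv⟩ := fp_cyc N hH
  have key : v = 1 := by
    by_contra hv1
    have : ∀ x, Commute v (x ^ (2 : ℤ)) := by
      intro x
      obtain ⟨k, hk⟩ := hv _ (hN.conj_mem v hvN x)
      obtain ⟨l, hl⟩ := hv _ (hN.conj_mem v hvN x⁻¹)
      exact fp_conj_sq v x hv1 k l hk (by simpa using hl)
    exact hv1 (fp_C v 2 2 (by simp) (by simp) (this _) (this _))
  obtain ⟨n, rfl⟩ := hv w hw
  simp [key]

theorem fp_ind {P : FreeGroup Bool → Prop} (one : P 1)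
    (h : ∀ b w, P w → P (FreeGroup.of b * w)) (h' : ∀ b w, P w → P ((FreeGroup.of b)⁻¹ * w)) :
    ∀ w, P w := by
  have : ∀ g w, P w → P (g * w) := by
    intro g
    induction g using FreeGroup.induction_on with
    | C1 => intro w hw; simpa using hw
    | of b => exact h b
    | inv_of b _ => exact h' b
    | mul x y hx hy => intro w hw; rw [mul_assoc]; exact hx _ (hy _ hw)
  intro w
  simpa using this w 1 one

section

variable {R : Type*} [Ring R]

theorem fp_inv (u : Rˣ) (c : R) (hc : c * c = 0) (hu : (u : R) = 1 + c) :
    ((u⁻¹ : Rˣ) : R) = 1 - c := by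
  apply Units.inv_eq_of_mul_eq_one_right
  rw [hu]
  have : (1 + c) * (1 - c) = 1 - c * c := by noncomm_ring
  rw [this, hc, sub_zero]

theorem fp_pow (u : Rˣ) (c : R) (hc : c * c = 0) (hu : (u : R) = 1 + c) (k : ℕ) :
    ((u ^ k : Rˣ) : R) = 1 + (k : ℤ) • c := by
  induction k with
  | zero => simp
  | succ k ih =>
    rw [pow_succ, Units.val_mul, ih, hu]
    simp only [add_mul, mul_add, one_mul, mul_one, smul_mul_assoc, hc]
    push_cast
    module

/-- Homs given by unipotent elements with scaled square-zero parts. -/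
structure FPHom (a b : R) (ρ : FreeGroup Bool →* Rˣ) (i j : ℤ) : Prop where
  ha : a * a = 0
  hb : b * b = 0
  ht : (ρ (FreeGroup.of true) : R) = 1 + i • a
  hf : (ρ (FreeGroup.of false) : R) = 1 + j • b
  ht' : (((ρ (FreeGroup.of true))⁻¹ : Rˣ) : R) = 1 - i • a
  hf' : (((ρ (FreeGroup.of false))⁻¹ : Rˣ) : R) = 1 - j • b

theorem FPHom.mk' {a b : R} (ha : a * a = 0) (hb : b * b = 0) (α β : Rˣ)
    (hα : (α : R) = 1 + a) (hβ : (β : R) = 1 + b) (i j : ℕ) :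
    FPHom a b (FreeGroup.lift (fun c : Bool => if c then α ^ i else β ^ j)) i j := by
  have h1 := fp_pow α a ha hα i
  have h2 := fp_pow β b hb hβ j
  refine ⟨ha, hb, by simpa [-zsmul_eq_mul] using h1, by simpa [-zsmul_eq_mul] using h2, ?_, ?_⟩
  · simpa [-zsmul_eq_mul] using fp_inv (α ^ i) _ (by simp only [smul_mul_assoc, mul_smul_comm, ha, smul_zero]) h1
  · simpa [-zsmul_eq_mul] using fp_inv (β ^ j) _ (by simp only [smul_mul_assoc, mul_smul_comm, hb, smul_zero]) h2

variable {a b : R} {ρ : FreeGroup Bool →* Rˣ} {i j : ℤ}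

theorem FPHom.left (H : FPHom a b ρ i j) (w : FreeGroup Bool) :
    ∃ r s : R, (ρ w : R) = 1 + r * a + s * b := by
  induction w using FreeGroup.induction_on with
  | C1 => exact ⟨0, 0, by simp⟩
  | of c =>
    cases c
    · exact ⟨0, j • 1, by
        rw [H.hf]
        simp only [zero_mul, mul_zero, add_zero, smul_mul_assoc, mul_smul_comm, one_mul, mul_one, neg_smul,
          sub_eq_add_neg, neg_mul, mul_neg]⟩
    · exact ⟨i • 1, 0, by
        rw [H.ht]
        simp only [zero_mul, mul_zero, add_zero, smul_mul_assoc, mul_smul_comm, one_mul, mul_one, neg_smul,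
          sub_eq_add_neg, neg_mul, mul_neg]⟩
  | inv_of c _ =>
    cases c
    · exact ⟨0, -j • 1, by
        rw [map_inv, H.hf']
        simp only [zero_mul, mul_zero, add_zero, smul_mul_assoc, mul_smul_comm, one_mul, mul_one, neg_smul,
          sub_eq_add_neg, neg_mul, mul_neg]⟩
    · exact ⟨-i • 1, 0, by
        rw [map_inv, H.ht']
        simp only [zero_mul, mul_zero, add_zero, smul_mul_assoc, mul_smul_comm, one_mul, mul_one, neg_smul,
          sub_eq_add_neg, neg_mul, mul_neg]⟩
  | mul x y hx hy =>
    obtain ⟨r, s, h1⟩ := hx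
    obtain ⟨r', s', h2⟩ := hy
    refine ⟨r + ρ x * r', s + ρ x * s', ?_⟩
    rw [map_mul, Units.val_mul, h2, mul_add, mul_add, mul_one]
    nth_rewrite 1 [h1]
    noncomm_ring

theorem FPHom.right (H : FPHom a b ρ i j) (w : FreeGroup Bool) :
    ∃ r s : R, (ρ w : R) = 1 + a * r + b * s := by
  induction w using FreeGroup.induction_on with
  | C1 => exact ⟨0, 0, by simp⟩
  | of c =>
    cases c
    · exact ⟨0, j • 1, by
        rw [H.hf]
        simp only [zero_mul, mul_zero, add_zero, smul_mul_assoc, mul_smul_comm, one_mul, mul_one, neg_smul,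
          sub_eq_add_neg, neg_mul, mul_neg]⟩
    · exact ⟨i • 1, 0, by
        rw [H.ht]
        simp only [zero_mul, mul_zero, add_zero, smul_mul_assoc, mul_smul_comm, one_mul, mul_one, neg_smul,
          sub_eq_add_neg, neg_mul, mul_neg]⟩
  | inv_of c _ =>
    cases c
    · exact ⟨0, -j • 1, by
        rw [map_inv, H.hf']
        simp only [zero_mul, mul_zero, add_zero, smul_mul_assoc, mul_smul_comm, one_mul, mul_one, neg_smul,
          sub_eq_add_neg, neg_mul, mul_neg]⟩
    · exact ⟨-i • 1, 0, by
        rw [map_inv, H.ht']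
        simp only [zero_mul, mul_zero, add_zero, smul_mul_assoc, mul_smul_comm, one_mul, mul_one, neg_smul,
          sub_eq_add_neg, neg_mul, mul_neg]⟩
  | mul x y hx hy =>
    obtain ⟨r, s, h1⟩ := hx
    obtain ⟨r', s', h2⟩ := hy
    refine ⟨r' + r * ρ y, s' + s * ρ y, ?_⟩
    rw [map_mul, Units.val_mul, h1, add_mul, add_mul, one_mul]
    nth_rewrite 1 [h2]
    noncomm_ring

/-- `k • J f J = 0`. -/
structure FPD (a b : R) (k : ℤ) (f : R) : Prop where
  aa : k • (a * f * a) = 0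
  ab : k • (a * f * b) = 0
  ba : k • (b * f * a) = 0
  bb : k • (b * f * b) = 0

theorem FPD.add {k : ℤ} {f g : R} (hf : FPD a b k f) (hg : FPD a b k g) : FPD a b k (f + g) := by
  constructor <;>
  simp only [mul_add, add_mul, smul_add, hf.aa, hf.ab, hf.ba, hf.bb, hg.aa, hg.ab, hg.ba, hg.bb,
    add_zero]

theorem FPD.neg {k : ℤ} {f : R} (hf : FPD a b k f) : FPD a b k (-f) := by
  constructor <;>
  simp only [mul_neg, neg_mul, smul_neg, hf.aa, hf.ab, hf.ba, hf.bb, neg_zero]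

theorem FPD.lmul (H : FPHom a b ρ i j) {k : ℤ} {f : R} (hf : FPD a b k f) (w : FreeGroup Bool) :
    FPD a b k (ρ w * f) := by
  obtain ⟨r, s, h⟩ := H.left w
  have e : ∀ x y : R, k • (x * (ρ w * f) * y) =
      k • (x * f * y) + x * r * (k • (a * f * y)) + x * s * (k • (b * f * y)) := by
    intro x y
    rw [h]
    simp only [mul_add, add_mul, one_mul, mul_one, mul_assoc, smul_add, mul_smul_comm]
  constructor <;> rw [e] <;> simp [hf.aa, hf.ab, hf.ba, hf.bb]

theorem FPD.rmul (H : FPHom a b ρ i j) {k : ℤ} {f : R} (hf : FPD a b k f) (w : FreeGroup Bool) :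
    FPD a b k (f * ρ w) := by
  obtain ⟨r, s, h⟩ := H.right w
  have e : ∀ x y : R, k • (x * (f * ρ w) * y) =
      k • (x * f * y) + (k • (x * f * a)) * (r * y) + (k • (x * f * b)) * (s * y) := by
    intro x y
    rw [h]
    simp only [mul_add, add_mul, one_mul, mul_one, mul_assoc, smul_add, smul_mul_assoc]
  constructor <;> rw [e] <;> simp [hf.aa, hf.ab, hf.ba, hf.bb]

theorem FPD.triple (H : FPHom a b ρ i j) {k : ℤ} {f : R} (hf : FPD a b k f)
    (w w' : FreeGroup Bool) : k • ((ρ w - 1) * f * (ρ w' - 1) : R) = 0 := by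
  obtain ⟨r, s, h⟩ := H.left w
  obtain ⟨r', s', h'⟩ := H.right w'
  have e : k • ((ρ w - 1) * f * (ρ w' - 1) : R) =
      r * (k • (a * f * a)) * r' + r * (k • (a * f * b)) * s' + s * (k • (b * f * a)) * r'
        + s * (k • (b * f * b)) * s' := by
    rw [h, h']
    simp only [add_sub_cancel_left, add_assoc, mul_add, add_mul, mul_assoc, smul_add,
      smul_mul_assoc, mul_smul_comm]
    abel
  rw [e]
  simp [hf.aa, hf.ab, hf.ba, hf.bb]

/-- The words acting trivially up to `k`-torsion. -/
def fpN (H : FPHom a b ρ i j) (k : ℤ) : Subgroup (FreeGroup Bool) where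
  carrier := {w | FPD a b k ((ρ w : R) - 1)}
  one_mem' := by constructor <;> simp
  mul_mem' := by
    intro x y hx hy
    have := (hx.rmul H y).add hy
    simp only [Set.mem_ofPred_eq, map_mul, Units.val_mul]
    convert this using 1
    noncomm_ring
  inv_mem' := by
    intro x hx
    have := (hx.rmul H x⁻¹).neg
    simp only [Set.mem_ofPred_eq]
    convert this using 1
    rw [sub_mul, ← Units.val_mul, ← map_mul]
    simp

theorem fpN_normal (H : FPHom a b ρ i j) (k : ℤ) : (fpN H k).Normal := by
  refine ⟨fun x hx g => ?_⟩
  have hx : FPD a b k ((ρ x : R) - 1) := hx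
  have := (hx.rmul H g⁻¹).lmul H g
  change FPD a b k ((ρ (g * x * g⁻¹) : R) - 1)
  convert this using 1
  rw [sub_mul, mul_sub, ← Units.val_mul, ← Units.val_mul, one_mul, ← Units.val_mul,
    ← map_mul, ← map_mul, ← map_mul]
  simp [mul_assoc]

theorem fp_T (H : FPHom a b ρ i j) (hρ : Function.Injective ρ) {k : ℕ} (hk : k ≠ 0)
    (w : FreeGroup Bool) (hw : (k : ℤ) • ((ρ w : R) - 1) = 0) : w = 1 := by
  have key : ∀ (c : R) (x : FreeGroup Bool), c * c = 0 → (ρ x : R) = 1 + c →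
      Commute w (x ^ (k : ℤ)) := by
    intro c x hc hx
    apply hρ
    apply Units.ext
    have h1 : (ρ (x ^ (k : ℤ)) : R) = 1 + (k : ℤ) • c := by
      rw [zpow_natCast, map_pow]; exact fp_pow _ c hc hx k
    have h2 : (k : ℤ) • ((ρ w : R) * c) = (k : ℤ) • c := by
      rw [← sub_eq_zero, ← smul_sub]
      have := congrArg (· * c) hw
      simpa only [smul_mul_assoc, sub_mul, one_mul, zero_mul] using this
    have h3 : (k : ℤ) • (c * (ρ w : R)) = (k : ℤ) • c := by
      rw [← sub_eq_zero, ← smul_sub]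
      have := congrArg (c * ·) hw
      simpa only [mul_smul_comm, mul_sub, mul_one, mul_zero] using this
    rw [map_mul, map_mul, Units.val_mul, Units.val_mul, h1, mul_add, add_mul, mul_smul_comm,
      smul_mul_assoc, h2, h3, mul_one, one_mul]
  refine fp_C w k k (by exact_mod_cast hk) (by exact_mod_cast hk) (key (i • a) _ ?_ H.ht)
    (key (j • b) _ ?_ H.hf)
  · simp [-zsmul_eq_mul, smul_mul_assoc, mul_smul_comm, H.ha]
  · simp [-zsmul_eq_mul, smul_mul_assoc, mul_smul_comm, H.hb]

theorem fp_main (H : FPHom a b ρ i j) (hρ : Function.Injective ρ) {k : ℕ} (hk : k ≠ 0)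
    (w : FreeGroup Bool) (hw : FPD a b k ((ρ w : R) - 1)) : w = 1 := by
  refine fp_normal (fpN H k) (fpN_normal H k) ?_ w hw
  intro x hx y hy z hz
  have hx : FPD a b k ((ρ x : R) - 1) := hx
  have hy : FPD a b k ((ρ y : R) - 1) := hy
  set c := x * y * x⁻¹ * y⁻¹ with hc
  obtain ⟨t, ht⟩ : ∃ t, t = x⁻¹ * y⁻¹ := ⟨_, rfl⟩
  /- the commutator minus one -/
  have h1 : (ρ c : R) - 1 =
      (((ρ x : R) - 1) * (ρ y - 1) - ((ρ y : R) - 1) * (ρ x - 1)) * ρ t := by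
    have e1 : (ρ c : R) = ρ x * ρ y * ρ t := by
      rw [← Units.val_mul, ← Units.val_mul, ← map_mul, ← map_mul]
      congr 2; simp [hc, ht, mul_assoc]
    have e2 : (1 : R) = ρ y * ρ x * ρ t := by
      rw [← Units.val_mul, ← Units.val_mul, ← map_mul, ← map_mul]
      simp [ht]
    rw [e1]
    nth_rewrite 1 [e2]
    noncomm_ring
  have h2 : (k : ℤ) • (((ρ c : R) - 1) * (ρ z - 1)) = 0 := by
    have e : (k : ℤ) • (((ρ c : R) - 1) * (ρ z - 1)) =
        (k : ℤ) • (((ρ x : R) - 1) * (ρ y - 1) * (ρ (t * z) - 1))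
        - (k : ℤ) • (((ρ x : R) - 1) * (ρ y - 1) * (ρ t - 1))
        - (k : ℤ) • (((ρ y : R) - 1) * (ρ x - 1) * (ρ (t * z) - 1))
        + (k : ℤ) • (((ρ y : R) - 1) * (ρ x - 1) * (ρ t - 1)) := by
      rw [h1, map_mul ρ t z, Units.val_mul, ← smul_sub, ← smul_sub, ← smul_add]
      congr 1
      noncomm_ring
    rw [e, hy.triple H, hy.triple H, hx.triple H, hx.triple H]
    simp
  have h3 : (k : ℤ) • (((ρ z : R) - 1) * (ρ c - 1)) = 0 := by
    have e : (k : ℤ) • (((ρ z : R) - 1) * (ρ c - 1)) =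
        ((k : ℤ) • (((ρ z : R) - 1) * (ρ x - 1) * (ρ y - 1))
        - (k : ℤ) • (((ρ z : R) - 1) * (ρ y - 1) * (ρ x - 1))) * ρ t := by
      rw [h1, ← smul_sub, smul_mul_assoc]
      congr 1
      noncomm_ring
    rw [e, hx.triple H, hy.triple H]
    simp
  have h4 : c * z * (z * c)⁻¹ = 1 := by
    apply fp_T H hρ hk
    have e : (ρ (c * z * (z * c)⁻¹) : R) - 1 =
        (((ρ c : R) - 1) * (ρ z - 1) - ((ρ z : R) - 1) * (ρ c - 1)) * ρ ((z * c)⁻¹) := by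
      have e1 : (1 : R) = ρ z * ρ c * ρ ((z * c)⁻¹) := by
        rw [← Units.val_mul, ← Units.val_mul, ← map_mul, ← map_mul]
        simp
      rw [map_mul, map_mul, Units.val_mul, Units.val_mul]
      nth_rewrite 1 [e1]
      noncomm_ring
    rw [e, ← smul_mul_assoc, smul_sub, h2, h3]
    simp
  exact mul_inv_eq_one.1 h4

theorem fp_decomp {ρ₁ ρ₂ : FreeGroup Bool →* Rˣ} {m n : ℤ}
    (H₁ : FPHom a b ρ₁ m n) (H₂ : FPHom a b ρ₂ 1 (m * n)) (w : FreeGroup Bool) :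
    ∃ z p q : R, (ρ₁ w : R) = z + m • p + q ∧ (ρ₂ w : R) = z + p + m • q ∧
      a * p = 0 ∧ p * a = 0 ∧ b * q = 0 ∧ q * b = 0 ∧ a * z * a = 0 ∧ b * z * b = 0 := by
  have ha := H₁.ha
  have hb := H₁.hb
  have ha' : ∀ x, a * (a * x) = 0 := fun x => by rw [← mul_assoc, ha, zero_mul]
  have hb' : ∀ x, b * (b * x) = 0 := fun x => by rw [← mul_assoc, hb, zero_mul]
  induction w using fp_ind with
  | one => exact ⟨1, 0, 0, by simp [ha, hb]⟩
  | h c w ih =>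
    obtain ⟨z, p, q, h1, h2, ap, pa, bq, qb, aza, bzb⟩ := ih
    rw [mul_assoc] at aza bzb
    cases c
    · refine ⟨z + (m * n) • (b * p), p, q + n • (b * z), ?_, ?_, ap, pa, ?_, ?_, ?_, ?_⟩
      · rw [map_mul, Units.val_mul, H₁.hf, h1]
        simp only [add_mul, mul_add, one_mul, smul_mul_assoc, mul_smul_comm, bq]
        module
      · rw [map_mul, Units.val_mul, H₂.hf, h2]
        simp only [add_mul, mul_add, one_mul, smul_mul_assoc, mul_smul_comm, bq]
        module
      all_goals simp [-zsmul_eq_mul, mul_add, add_mul, mul_assoc, smul_mul_assoc, mul_smul_comm, *]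
    · refine ⟨z + m • (a * q), p + a * z, q, ?_, ?_, ?_, ?_, bq, qb, ?_, ?_⟩
      · rw [map_mul, Units.val_mul, H₁.ht, h1]
        simp only [add_mul, mul_add, one_mul, smul_mul_assoc, mul_smul_comm, ap]
        module
      · rw [map_mul, Units.val_mul, H₂.ht, h2]
        simp only [add_mul, mul_add, one_mul, smul_mul_assoc, mul_smul_comm, ap]
        module
      all_goals simp [-zsmul_eq_mul, mul_add, add_mul, mul_assoc, smul_mul_assoc, mul_smul_comm, *]
  | h' c w ih =>
    obtain ⟨z, p, q, h1, h2, ap, pa, bq, qb, aza, bzb⟩ := ih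
    rw [mul_assoc] at aza bzb
    cases c
    · refine ⟨z - (m * n) • (b * p), p, q - n • (b * z), ?_, ?_, ap, pa, ?_, ?_, ?_, ?_⟩
      · rw [map_mul, map_inv, Units.val_mul, H₁.hf', h1]
        simp only [sub_mul, mul_add, one_mul, smul_mul_assoc, mul_smul_comm, bq]
        module
      · rw [map_mul, map_inv, Units.val_mul, H₂.hf', h2]
        simp only [sub_mul, mul_add, one_mul, smul_mul_assoc, mul_smul_comm, bq]
        module
      all_goals simp [-zsmul_eq_mul, mul_sub, sub_mul, mul_assoc, smul_mul_assoc, mul_smul_comm, *]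
    · refine ⟨z - m • (a * q), p - a * z, q, ?_, ?_, ?_, ?_, bq, qb, ?_, ?_⟩
      · rw [map_mul, map_inv, Units.val_mul, H₁.ht', h1]
        simp only [sub_mul, mul_add, one_mul, smul_mul_assoc, mul_smul_comm, ap]
        module
      · rw [map_mul, map_inv, Units.val_mul, H₂.ht', h2]
        simp only [sub_mul, mul_add, one_mul, smul_mul_assoc, mul_smul_comm, ap]
        module
      all_goals simp [-zsmul_eq_mul, mul_sub, sub_mul, mul_assoc, smul_mul_assoc, mul_smul_comm, *]

theorem fp_transfer {ρ₁ ρ₂ : FreeGroup Bool →* Rˣ} {m n : ℤ}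
    (H₁ : FPHom a b ρ₁ m n) (H₂ : FPHom a b ρ₂ 1 (m * n)) (w : FreeGroup Bool) :
    (ρ₁ w = 1 → FPD a b m ((ρ₂ w : R) - 1)) ∧ (ρ₂ w = 1 → FPD a b m ((ρ₁ w : R) - 1)) := by
  have ha := H₁.ha
  have hb := H₁.hb
  obtain ⟨z, p, q, h1, h2, ap, pa, bq, qb, aza, bzb⟩ := fp_decomp H₁ H₂ w
  have e1 : ∀ x y : R, x * ρ₁ w * y = x * z * y + m • (x * p * y) + x * q * y := by
    intro x y
    rw [h1]; simp only [mul_add, add_mul, smul_mul_assoc, mul_smul_comm]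
  have e2 : ∀ x y : R, x * ρ₂ w * y = x * z * y + x * p * y + m • (x * q * y) := by
    intro x y
    rw [h2]; simp only [mul_add, add_mul, smul_mul_assoc, mul_smul_comm]
  have apx : ∀ x, a * p * x = 0 := fun x => by rw [ap, zero_mul]
  have bqx : ∀ x, b * q * x = 0 := fun x => by rw [bq, zero_mul]
  have xpa : ∀ x, x * p * a = 0 := fun x => by rw [mul_assoc, pa, mul_zero]
  have xqb : ∀ x, x * q * b = 0 := fun x => by rw [mul_assoc, qb, mul_zero]
  constructor
  · intro h
    have aa := e1 a a
    have ab := e1 a b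
    have ba := e1 b a
    have bb := e1 b b
    simp only [h, Units.val_one, mul_one, ha, hb, aza, bzb, apx, bqx, xpa, xqb, smul_zero,
      add_zero, zero_add] at aa ab ba bb
    constructor <;> rw [mul_sub, sub_mul, e2] <;>
      simp [ha, hb, aza, bzb, apx, bqx, xpa, xqb, ← aa, ← ab, ← ba, ← bb]
  · intro h
    have aa := e2 a a
    have ab := e2 a b
    have ba := e2 b a
    have bb := e2 b b
    simp only [h, Units.val_one, mul_one, ha, hb, aza, bzb, apx, bqx, xpa, xqb, smul_zero,
      add_zero, zero_add] at aa ab ba bb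
    constructor <;> rw [mul_sub, sub_mul, e1] <;>
      simp [ha, hb, aza, bzb, apx, bqx, xpa, xqb, ← aa, ← ab, ← ba, ← bb]

end

/-- **Corollary 3.1(1).** Let `R` be a ring of characteristic `0`, `a, b ∈ R` with
`a² = b² = 0`, and `α = 1 + a`, `β = 1 + b` the corresponding units. For positive
integers `m` and `n`, `(α^m, β^n)` is a free pair iff `(α, β^{mn})` is a free pair. -/
theorem free_pair_pow_iff (R : Type*) [Ring R] [CharZero R] (a b : R)
    (ha : a ^ 2 = 0) (hb : b ^ 2 = 0)
    (α β : Rˣ) (hα : (α : R) = 1 + a) (hβ : (β : R) = 1 + b)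
    (m n : ℕ) (hm : 0 < m) (hn : 0 < n) :
    IsFreePair (α ^ m) (β ^ n) ↔ IsFreePair α (β ^ (m * n)) := by
  rw [pow_two] at ha hb
  have H₁ := FPHom.mk' ha hb α β hα hβ m n
  have H₂ := FPHom.mk' ha hb α β hα hβ 1 (m * n)
  simp only [pow_one, Nat.cast_one, Nat.cast_mul] at H₂
  unfold IsFreePair
  constructor
  · intro h
    rw [injective_iff_map_eq_one]
    intro w hw
    exact fp_main H₁ h hm.ne' w ((fp_transfer H₁ H₂ w).2 hw)
  · intro h
    rw [injective_iff_map_eq_one]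
    intro w hw
    exact fp_main H₂ h hm.ne' w ((fp_transfer H₁ H₂ w).1 hw)
end
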